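/- Explicit parity formula: for positive integers k₁,…,k_d with k_d ≥ 2 and k₁+⋯+k_d ≢ d (mod 2), one has ζ(k₁,…,k_d) = (ζ(k₁,…,k_d) − ζ^⋆(k₁,…,k_d))/2 − ∑_{0≤i<j≤d} ∑_{a+2m+b=k_j, a,b,m≥0} (-1)^{m+i+b+k₁+⋯+k_j} (2π)^{2m} B_{2m}/(2·(2m)!) · ζ^{⋆,*}(k₁,…,k_i) ζ_a^*(k_{j-1},…,k_{i+1}) ζ_b(k_{j+1},…,k_d). -/

import Mathlib

open scoped BigOperators
open Real

/-- The multiple zeta value `ζ(k₁,…,k_d) = ∑_{0<m₁<⋯<m_d} ∏ 1/m_i^{k_i}`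
(as a `tsum` over strictly increasing tuples of positive integers). -/
noncomputable def MZV (k : List ℕ) : ℝ :=
  ∑' m : {f : Fin k.length → ℕ+ // StrictMono f}, ∏ i, 1 / ((m.1 i : ℕ) : ℝ) ^ k.get i

/-- The stuffle (quasi-shuffle) product of two words, as a multiset of words. -/
def stuffle : List ℕ → List ℕ → Multiset (List ℕ)
  | [], v => {v}
  | u, [] => {u}
  | a :: u, b :: v =>
      (stuffle u (b :: v)).map (a :: ·) + (stuffle (a :: u) v).map (b :: ·) +
        (stuffle u v).map ((a + b) :: ·)
  termination_by u v => u.length + v.length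

/-- All contractions of a word: the results of replacing each comma by `,` or `+`. -/
def contractions : List ℕ → Multiset (List ℕ)
  | [] => {[]}
  | [a] => {[a]}
  | a :: b :: t => (contractions (b :: t)).map (a :: ·) + contractions ((a + b) :: t)
  termination_by l => l.length

/-- `Z` is a stuffle (harmonic) regularization of multiple zeta values:
it takes the value `1` on the empty word, agrees with the convergent multiple zeta
values on admissible words, and is a homomorphism for the stuffle product. -/
structure IsStuffleReg (Z : List ℕ → ℝ) : Prop where
  empty : Z [] = 1
  conv : ∀ l : List ℕ, (∀ i ∈ l, 0 < i) → 2 ≤ l.getLastD 2 → Z l = MZV l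
  mul : ∀ u v : List ℕ, (∀ i ∈ u, 0 < i) → (∀ i ∈ v, 0 < i) →
    Z u * Z v = ((stuffle u v).map Z).sum

/-- The star version `ζ^{⋆,*}(k₁,…,k_d)`: the sum of `Z` over all contractions. -/
noncomputable def zetaStarOf (Z : List ℕ → ℝ) (l : List ℕ) : ℝ :=
  ((contractions l).map Z).sum

/-- `ζ_a^*(l₁,…,l_r) = (-1)^a ∑_{a₁+⋯+a_r=a} ζ^*(l₁+a₁,…,l_r+a_r) ∏ C(l_i-1+a_i,a_i)`. -/
noncomputable def zetaA (Z : List ℕ → ℝ) (a : ℕ) (l : List ℕ) : ℝ :=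
  (-1 : ℝ) ^ a *
    ∑ f ∈ (Fintype.piFinset fun _ : Fin l.length => Finset.range (a + 1)).filter
        (fun f => ∑ i, f i = a),
      Z (List.ofFn fun i => l.get i + f i) *
        ∏ i, (Nat.choose (l.get i - 1 + f i) (f i) : ℝ)

/-- `δ^{k₁,…,k_d}`: equal to `(-1)^n π^{2n}/(2n)!` if `(k₁,…,k_d) = (1,…,1)` has even
length `2n`, and `0` otherwise. -/
noncomputable def deltaVal (l : List ℕ) : ℝ :=
  if l.all (· = 1) ∧ l.length % 2 = 0 then
    (-1 : ℝ) ^ (l.length / 2) * π ^ l.length / (Nat.factorial l.length) else 0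

/-- The monomial quasi-symmetric function of a word, evaluated at a finite list of elements. -/
def qsym {R : Type*} [CommSemiring R] : List R → List ℕ → R
  | _, [] => 1
  | [], _ :: _ => 0
  | x :: xs, k :: w => qsym xs (k :: w) + x ^ k * qsym xs w

section QSym

variable {R : Type*} [CommRing R]

@[simp] lemma qsym_nil_right (xs : List R) : qsym xs [] = 1 := by
  cases xs <;> rfl

@[simp] lemma qsym_nil_cons (k : ℕ) (w : List ℕ) : qsym ([] : List R) (k :: w) = 0 := rfl

lemma qsym_cons_cons (x : R) (xs : List R) (k : ℕ) (w : List ℕ) :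
    qsym (x :: xs) (k :: w) = qsym xs (k :: w) + x ^ k * qsym xs w := rfl

lemma map_qsym {S : Type*} [CommRing S] (f : R →+* S) (xs : List R) (w : List ℕ) :
    f (qsym xs w) = qsym (xs.map f) w := by
  induction xs generalizing w with
  | nil => cases w <;> simp
  | cons x xs ih => cases w <;> simp [qsym_cons_cons, ih]

@[simp] lemma qsym_nil_append_singleton (w : List ℕ) (k : ℕ) :
    qsym ([] : List R) (w ++ [k]) = 0 := by
  cases w <;> simp

lemma qsym_append_singleton (xs : List R) (x : R) (w : List ℕ) (k : ℕ) :
    qsym (xs ++ [x]) (w ++ [k]) = qsym xs (w ++ [k]) + x ^ k * qsym xs w := by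
  induction xs generalizing w with
  | nil => cases w <;> simp [qsym_cons_cons]
  | cons y ys ih =>
    cases w with
    | nil =>
      have := ih []
      simp only [List.nil_append, List.cons_append, qsym_cons_cons, qsym_nil_right] at this ⊢
      rw [this]; ring
    | cons a w =>
      have h1 := ih (a :: w)
      have h2 := ih w
      simp only [List.cons_append, qsym_cons_cons] at h1 h2 ⊢
      rw [h1, h2]; ring

lemma qsym_reverse (xs : List R) (w : List ℕ) :
    qsym xs.reverse w.reverse = qsym xs w := by
  induction xs generalizing w with
  | nil => cases w <;> simp
  | cons x xs ih =>
    cases w with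
    | nil => simp
    | cons k w =>
      rw [List.reverse_cons, List.reverse_cons, qsym_append_singleton, ← List.reverse_cons,
        ih, ih, qsym_cons_cons]

lemma qsym_map_mul (c : R) (xs : List R) (w : List ℕ) :
    qsym (xs.map (c * ·)) w = c ^ w.sum * qsym xs w := by
  induction xs generalizing w with
  | nil => cases w <;> simp
  | cons x xs ih =>
    cases w with
    | nil => simp
    | cons k w =>
      simp only [List.map_cons, qsym_cons_cons, ih, List.sum_cons]
      ring

lemma qsym_append (xs ys : List R) (w : List ℕ) :
    qsym (xs ++ ys) w =
      ∑ i ∈ Finset.range (w.length + 1), qsym xs (w.take i) * qsym ys (w.drop i) := by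
  induction xs generalizing w with
  | nil =>
    rw [Finset.sum_range_succ']
    cases w <;> simp
  | cons x xs ih =>
    cases w with
    | nil => simp
    | cons k w =>
      rw [List.cons_append, qsym_cons_cons, ih, ih, List.length_cons, Finset.sum_range_succ',
        Finset.sum_range_succ' (n := w.length + 1)]
      simp only [List.take_succ_cons, List.drop_succ_cons, List.take_zero, List.drop_zero,
        qsym_nil_right, qsym_cons_cons, add_mul, Finset.sum_add_distrib, Finset.mul_sum]
      rw [add_right_comm]
      simp only [mul_assoc]

lemma qsym_append_cons (xs ys : List R) (x : R) (w : List ℕ) :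
    qsym (xs ++ x :: ys) w =
      ∑ i ∈ Finset.range (w.length + 1), qsym xs (w.take i) * qsym ys (w.drop i) +
      ∑ j ∈ Finset.range w.length,
        qsym xs (w.take j) * (x ^ w.getD j 0 * qsym ys (w.drop (j + 1))) := by
  rw [qsym_append, Finset.sum_range_succ, Finset.sum_range_succ, add_right_comm,
    ← Finset.sum_add_distrib]
  congr 1
  · refine Finset.sum_congr rfl fun j hj => ?_
    have hj' := Finset.mem_range.1 hj
    rw [List.drop_eq_getElem_cons hj', qsym_cons_cons, mul_add, List.getD_eq_getElem _ _ hj']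
  · simp

lemma qsym_mul (xs : List R) (u v : List ℕ) :
    qsym xs u * qsym xs v = ((stuffle u v).map (qsym xs)).sum := by
  induction xs generalizing u v with
  | nil =>
    cases u <;> cases v <;> simp [stuffle, Function.comp_def]
  | cons x xs ih =>
    cases u with
    | nil => simp [stuffle]
    | cons a u =>
      cases v with
      | nil => simp [stuffle]
      | cons b v =>
        have h1 := ih (a :: u) (b :: v)
        rw [stuffle] at h1 ⊢
        simp only [Multiset.map_add, Multiset.sum_add, Multiset.map_map, Function.comp_def,
          qsym_cons_cons, Multiset.sum_map_add, Multiset.sum_map_mul_left, ← ih] at h1 ⊢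
        rw [add_mul, mul_add, mul_add, h1, pow_add]
        ring

/-- The star version of `qsym`. -/
def qsymStar (xs : List R) (w : List ℕ) : R := ((contractions w).map (qsym xs)).sum

@[simp] lemma qsymStar_nil_right (xs : List R) : qsymStar xs [] = 1 := by
  simp [qsymStar, contractions]

lemma qsymStar_singleton (xs : List R) (k : ℕ) : qsymStar xs [k] = qsym xs [k] := by
  simp [qsymStar, contractions]

lemma qsymStar_cons_cons_right (xs : List R) (a b : ℕ) (t : List ℕ) :
    qsymStar xs (a :: b :: t) =
      ((contractions (b :: t)).map fun c => qsym xs (a :: c)).sum + qsymStar xs ((a + b) :: t) := by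
  simp [qsymStar, contractions]

lemma qsymStar_nil_cons (k : ℕ) (w : List ℕ) : qsymStar ([] : List R) (k :: w) = 0 := by
  induction w generalizing k with
  | nil => simp [qsymStar_singleton]
  | cons b t ih => simp [qsymStar_cons_cons_right, ih]

lemma qsymStar_cons_cons (x : R) (xs : List R) (k : ℕ) (w : List ℕ) :
    qsymStar (x :: xs) (k :: w) = qsymStar xs (k :: w) + x ^ k * qsymStar (x :: xs) w := by
  induction w generalizing k with
  | nil => simp [qsymStar_singleton, qsym_cons_cons]
  | cons b t ih =>
    rw [qsymStar_cons_cons_right, qsymStar_cons_cons_right, ih, ih]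
    simp only [qsym_cons_cons, Multiset.sum_map_add, Multiset.sum_map_mul_left]
    rw [← qsymStar]
    ring

lemma qsym_cons_append_singleton_reverse (x : R) (xs : List R) (w : List ℕ) (k : ℕ) :
    qsym (x :: xs) (w ++ [k]).reverse =
      qsym xs (w ++ [k]).reverse + x ^ k * qsym xs w.reverse := by
  simp [qsym_cons_cons]

lemma sum_qsymStar_mul_qsym_reverse_aux (x : R) (xs : List R)
    (h : ∀ k w, ∑ i ∈ Finset.range ((k :: w).length + 1),
      (-1) ^ i * qsymStar xs ((k :: w).take i) * qsym xs ((k :: w).drop i).reverse = 0)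
    (w : List ℕ) :
    ∑ i ∈ Finset.range (w.length + 1),
      (-1) ^ i * qsymStar (x :: xs) (w.take i) * qsym xs (w.drop i).reverse =
      (-1) ^ w.length * x ^ w.sum := by
  induction w with
  | nil => simp
  | cons k w ih =>
    have h1 := h k w
    rw [List.length_cons, Finset.sum_range_succ'] at h1 ⊢
    simp only [List.take_succ_cons, List.drop_succ_cons, List.take_zero, List.drop_zero,
      qsymStar_nil_right, qsymStar_cons_cons, mul_add, add_mul, Finset.sum_add_distrib] at h1 ⊢
    rw [add_right_comm, h1, zero_add, List.sum_cons, pow_succ, pow_add]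
    have : ∀ i, (-1) ^ (i + 1) * (x ^ k * qsymStar (x :: xs) (w.take i)) *
        qsym xs (w.drop i).reverse = - x ^ k *
        ((-1) ^ i * qsymStar (x :: xs) (w.take i) * qsym xs (w.drop i).reverse) := by
      intro i; ring
    simp only [this, ← Finset.mul_sum, ih]
    ring

lemma sum_qsymStar_mul_qsym_reverse (xs : List R) (k : ℕ) (w : List ℕ) :
    ∑ i ∈ Finset.range ((k :: w).length + 1),
      (-1) ^ i * qsymStar xs ((k :: w).take i) * qsym xs ((k :: w).drop i).reverse = 0 := by
  induction xs generalizing k w with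
  | nil =>
    refine Finset.sum_eq_zero fun i hi => ?_
    cases i with
    | zero =>
      have : qsym ([] : List R) (k :: w).reverse = 0 := by simp
      simp only [List.drop_zero, this, mul_zero]
    | succ i => simp [qsymStar_nil_cons]
  | cons x xs ih =>
    obtain ⟨v, b, hv⟩ : ∃ v b, k :: w = v ++ [b] :=
      ⟨_, _, (List.dropLast_append_getLast (List.cons_ne_nil k w)).symm⟩
    have h1 := sum_qsymStar_mul_qsym_reverse_aux x xs ih (k :: w)
    have h2 := sum_qsymStar_mul_qsym_reverse_aux x xs ih v
    rw [hv] at h1 ⊢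
    rw [List.length_append, List.length_singleton, Finset.sum_range_succ] at h1 ⊢
    have key : ∀ i ∈ Finset.range (v.length + 1),
        (-1) ^ i * qsymStar (x :: xs) ((v ++ [b]).take i) *
          qsym (x :: xs) ((v ++ [b]).drop i).reverse =
        (-1) ^ i * qsymStar (x :: xs) ((v ++ [b]).take i) *
          qsym xs ((v ++ [b]).drop i).reverse +
        x ^ b * ((-1) ^ i * qsymStar (x :: xs) (v.take i) * qsym xs (v.drop i).reverse) := by
      intro i hi
      have hi' : i ≤ v.length := Nat.lt_succ_iff.1 (Finset.mem_range.1 hi)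
      rw [List.drop_append_of_le_length hi', qsym_cons_append_singleton_reverse,
        List.take_append_of_le_length hi']
      ring
    rw [Finset.sum_congr rfl key, Finset.sum_add_distrib, ← Finset.mul_sum, h2, add_right_comm]
    have hd : (v ++ [b]).drop (v.length + 1) = [] := by simp
    rw [hd] at h1 ⊢
    simp only [List.reverse_nil, qsym_nil_right] at h1 ⊢
    rw [h1, List.sum_append, List.sum_singleton]
    ring

end QSym

lemma qsym_nonneg {xs : List ℝ} (h : ∀ x ∈ xs, 0 ≤ x) (w : List ℕ) : 0 ≤ qsym xs w := by
  induction xs generalizing w with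
  | nil => cases w <;> simp
  | cons x xs ih =>
    cases w with
    | nil => simp
    | cons k w =>
      have hx : 0 ≤ x := h x (by simp)
      have ih' := ih fun y hy => h y (by simp [hy])
      rw [qsym_cons_cons]
      exact add_nonneg (ih' _) (mul_nonneg (pow_nonneg hx _) (ih' _))

lemma qsym_le_qsym_cons {xs : List ℝ} {x : ℝ} (h : ∀ y ∈ x :: xs, 0 ≤ y) (w : List ℕ) :
    qsym xs w ≤ qsym (x :: xs) w := by
  cases w with
  | nil => simp
  | cons k w =>
    rw [qsym_cons_cons]
    have := mul_nonneg (pow_nonneg (h x (by simp)) k)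
      (qsym_nonneg (xs := xs) (fun y hy => h y (by simp [hy])) w)
    linarith

lemma qsym_cons_le {xs : List ℝ} (h : ∀ x ∈ xs, 0 ≤ x ∧ x ≤ 1) {k : ℕ} (hk : 0 < k)
    (w : List ℕ) : qsym xs (k :: w) ≤ xs.sum * qsym xs w := by
  induction xs with
  | nil => simp
  | cons x xs ih =>
    have hx := h x (by simp)
    have h' : ∀ y ∈ xs, 0 ≤ y ∧ y ≤ 1 := fun y hy => h y (by simp [hy])
    have h0 := qsym_nonneg (fun y hy => (h' y hy).1) w
    have h1 := qsym_le_qsym_cons (fun y hy => (h y hy).1) w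
    have hs : 0 ≤ (x :: xs).sum := List.sum_nonneg fun y hy => (h y hy).1
    rw [qsym_cons_cons]
    calc qsym xs (k :: w) + x ^ k * qsym xs w ≤ xs.sum * qsym xs w + x * qsym xs w := by
          gcongr
          · exact ih h'
          · exact pow_le_of_le_one hx.1 hx.2 hk.ne'
      _ = (x :: xs).sum * qsym xs w := by rw [List.sum_cons]; ring
      _ ≤ _ := by gcongr

lemma qsym_le_pow {xs : List ℝ} (h : ∀ x ∈ xs, 0 ≤ x ∧ x ≤ 1) {w : List ℕ}
    (hw : ∀ k ∈ w, 0 < k) : qsym xs w ≤ xs.sum ^ w.length := by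
  have hs : 0 ≤ xs.sum := List.sum_nonneg fun y hy => (h y hy).1
  induction w with
  | nil => simp
  | cons k w ih =>
    calc qsym xs (k :: w) ≤ xs.sum * qsym xs w := qsym_cons_le h (hw k (by simp)) w
      _ ≤ xs.sum * xs.sum ^ w.length := by
          gcongr
          exact ih fun k hk => hw k (by simp [hk])
      _ = _ := by rw [List.length_cons, pow_succ']

section Truncation

open Filter Topology

/-- The list `1, 1/2, …, 1/M`. -/
noncomputable def recips (M : ℕ) : List ℝ := (List.range M).map fun i : ℕ => ((i : ℝ) + 1)⁻¹

/-- The harmonic numbers as real numbers. -/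
noncomputable def harm (M : ℕ) : ℝ := ∑ i ∈ Finset.range M, ((i : ℝ) + 1)⁻¹

lemma recips_succ (M : ℕ) : recips (M + 1) = recips M ++ [((M : ℝ) + 1)⁻¹] := by
  simp [recips, List.range_succ]

lemma sum_recips (M : ℕ) : (recips M).sum = harm M := by
  rw [harm, Finset.sum_range, recips, ← List.sum_ofFn]
  congr 1
  exact List.ext_getElem (by simp) (by simp)

lemma harm_succ (M : ℕ) : harm (M + 1) = harm M + ((M : ℝ) + 1)⁻¹ := Finset.sum_range_succ _ _

lemma harm_nonneg (M : ℕ) : 0 ≤ harm M := Finset.sum_nonneg fun i _ => by positivity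

lemma harm_mono : Monotone harm :=
  monotone_nat_of_le_succ fun M => by rw [harm_succ]; exact le_add_of_nonneg_right (by positivity)

lemma tendsto_harm_atTop : Tendsto harm atTop atTop := by
  have := Real.tendsto_sum_range_one_div_nat_succ_atTop
  exact this.congr fun M => by simp only [one_div, harm]

lemma mem_recips {M : ℕ} {x : ℝ} (hx : x ∈ recips M) : 0 ≤ x ∧ x ≤ 1 := by
  obtain ⟨i, -, rfl⟩ := List.mem_map.1 hx
  exact ⟨by positivity, inv_le_one_of_one_le₀ (by simp)⟩

lemma qsym_recips_nonneg (M : ℕ) (w : List ℕ) : 0 ≤ qsym (recips M) w :=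
  qsym_nonneg (fun _ h => (mem_recips h).1) w

lemma qsym_recips_le (M : ℕ) {w : List ℕ} (hw : ∀ k ∈ w, 0 < k) :
    qsym (recips M) w ≤ harm M ^ w.length := by
  rw [← sum_recips]
  exact qsym_le_pow (fun _ h => mem_recips h) hw

lemma qsym_recips_one (M : ℕ) : qsym (recips M) [1] = harm M := by
  induction M with
  | zero => simp [recips, harm]
  | succ M ih =>
    have := qsym_append_singleton (recips M) ((M : ℝ) + 1)⁻¹ [] 1
    rw [List.nil_append] at this
    rw [recips_succ, this, ih, harm_succ]
    simp

lemma harm_le_log (M : ℕ) : harm M ≤ 1 + log ((M : ℝ) + 1) := by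
  have h1 : harm M = (harmonic M : ℝ) := by simp [harm, harmonic]
  rw [h1]
  refine (harmonic_le_one_add_log M).trans ?_
  gcongr 1 + ?_
  rcases Nat.eq_zero_or_pos M with rfl | h
  · simp
  · exact Real.log_le_log (by exact_mod_cast h) (by linarith)

lemma exists_one_add_harm_pow_le (r : ℕ) :
    ∃ C, 0 ≤ C ∧ ∀ M : ℕ, (1 + harm M) ^ r ≤ C * √((M : ℝ) + 1) := by
  set ε : ℝ := 1 / (2 * (r + 1)) with hε
  have hε0 : 0 < ε := by positivity
  refine ⟨(2 + 1 / ε) ^ r, by positivity, fun M => ?_⟩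
  have hM : (1 : ℝ) ≤ M + 1 := by simp
  have h1 : 1 + harm M ≤ (2 + 1 / ε) * ((M : ℝ) + 1) ^ ε := by
    have h2 := Real.log_le_rpow_div (x := (M : ℝ) + 1) (by positivity) hε0
    have h3 : 1 ≤ ((M : ℝ) + 1) ^ ε := Real.one_le_rpow hM hε0.le
    have h4 := harm_le_log M
    have h5 : ((M : ℝ) + 1) ^ ε / ε = 1 / ε * ((M : ℝ) + 1) ^ ε := by ring
    linarith
  calc (1 + harm M) ^ r ≤ ((2 + 1 / ε) * ((M : ℝ) + 1) ^ ε) ^ r := by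
        gcongr
        exact add_nonneg zero_le_one (harm_nonneg M)
    _ = (2 + 1 / ε) ^ r * ((M : ℝ) + 1) ^ (ε * r) := by
        rw [mul_pow, Real.rpow_mul (by positivity), Real.rpow_natCast]
    _ ≤ _ := by
        rw [Real.sqrt_eq_rpow]
        refine mul_le_mul_of_nonneg_left (Real.rpow_le_rpow_of_exponent_le hM ?_) (by positivity)
        rw [hε, div_mul_eq_mul_div, div_le_div_iff₀ (by positivity) (by positivity)]
        linarith

lemma tendsto_one_add_harm_pow_div (r : ℕ) :
    Tendsto (fun M : ℕ => (1 + harm M) ^ r / ((M : ℝ) + 1)) atTop (𝓝 0) := by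
  obtain ⟨C, hC, h⟩ := exists_one_add_harm_pow_le r
  have h1 : Tendsto (fun M : ℕ => √((M : ℝ) + 1)) atTop atTop :=
    Real.tendsto_sqrt_atTop.comp (tendsto_atTop_add_const_right _ _ tendsto_natCast_atTop_atTop)
  have h2 : Tendsto (fun M : ℕ => C / √((M : ℝ) + 1)) atTop (𝓝 0) := h1.const_div_atTop C
  refine squeeze_zero (fun M => ?_) (fun M => ?_) h2
  · have := harm_nonneg M
    positivity
  · rw [div_le_div_iff₀ (by positivity) (by positivity)]
    calc _ ≤ C * √((M : ℝ) + 1) * √((M : ℝ) + 1) := by gcongr; exact h M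
      _ = _ := by rw [mul_assoc, Real.mul_self_sqrt (by positivity)]

lemma summable_harm_pow_div_sq (r : ℕ) :
    Summable fun M : ℕ => harm M ^ r / ((M : ℝ) + 1) ^ 2 := by
  obtain ⟨C, hC, h⟩ := exists_one_add_harm_pow_le r
  have h1 : Summable fun M : ℕ => C * (((M + 1 : ℕ) : ℝ) ^ (3 / 2 : ℝ))⁻¹ :=
    (((summable_nat_add_iff 1).2 (Real.summable_nat_rpow_inv.2 (by norm_num))).mul_left C)
  refine Summable.of_nonneg_of_le (fun M => ?_) (fun M => ?_) h1
  · have := harm_nonneg M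
    positivity
  · have h0 : (0 : ℝ) < (M : ℝ) + 1 := by positivity
    have h3 : harm M ^ r ≤ C * √((M : ℝ) + 1) :=
      (pow_le_pow_left₀ (harm_nonneg M) (by linarith) r).trans (h M)
    have h4 : ((M : ℝ) + 1) ^ 2 = ((M : ℝ) + 1) ^ (3 / 2 : ℝ) * √((M : ℝ) + 1) := by
      rw [Real.sqrt_eq_rpow, ← Real.rpow_add h0, ← Real.rpow_natCast]
      norm_num
    push_cast
    rw [h4, div_le_iff₀ (by positivity)]
    calc harm M ^ r ≤ C * √((M : ℝ) + 1) := h3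
      _ = _ := by
        have : ((M : ℝ) + 1) ^ (3 / 2 : ℝ) ≠ 0 := by positivity
        field_simp

lemma qsym_recips_succ_append_singleton (M : ℕ) (v : List ℕ) (k : ℕ) :
    qsym (recips (M + 1)) (v ++ [k]) =
      qsym (recips M) (v ++ [k]) + (((M : ℝ) + 1)⁻¹) ^ k * qsym (recips M) v := by
  rw [recips_succ, qsym_append_singleton]

/-- Sequences that stay negligible after multiplication by powers of harmonic numbers. -/
def Negligible (e : ℕ → ℝ) : Prop :=
  ∀ n : ℕ, Tendsto (fun M => e M * harm M ^ n) atTop (𝓝 0)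

lemma Negligible.tendsto {e : ℕ → ℝ} (h : Negligible e) : Tendsto e atTop (𝓝 0) := by
  simpa using h 0

lemma Negligible.add {e f : ℕ → ℝ} (he : Negligible e) (hf : Negligible f) :
    Negligible fun M => e M + f M := fun n => by
  simpa [add_mul] using (he n).add (hf n)

lemma Negligible.const_mul {e : ℕ → ℝ} (he : Negligible e) (c : ℝ) :
    Negligible fun M => c * e M := fun n => by
  simpa [mul_assoc] using (he n).const_mul c

lemma Negligible.mul {e f : ℕ → ℝ} (he : Negligible e) (hf : Negligible f) :
    Negligible fun M => e M * f M := fun n => by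
  simpa [mul_comm, mul_left_comm, mul_assoc] using (he n).mul hf.tendsto

lemma Negligible.mul_harm_pow {e : ℕ → ℝ} (he : Negligible e) (m : ℕ) :
    Negligible fun M => e M * harm M ^ m := fun n => by
  simpa [mul_assoc, ← pow_add] using he (m + n)

lemma Negligible.mul_eval {e : ℕ → ℝ} (he : Negligible e) (p : Polynomial ℝ) :
    Negligible fun M => e M * p.eval (harm M) := by
  induction p using Polynomial.induction_on' with
  | add p q hp hq => simpa [mul_add] using hp.add hq
  | monomial n a =>
    simpa [mul_left_comm] using (he.mul_harm_pow n).const_mul a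

lemma negligible_zero : Negligible fun _ => 0 := fun n => by simp

lemma exists_negligible_of_getLast {v : List ℕ} (hv : ∀ i ∈ v, 0 < i) {k : ℕ} (hk : 2 ≤ k) :
    ∃ l : ℝ, Negligible fun M => qsym (recips M) (v ++ [k]) - l := by
  set a : ℕ → ℝ := fun M => (((M : ℝ) + 1)⁻¹) ^ k * qsym (recips M) v with ha
  have ha0 : ∀ M, 0 ≤ a M := fun M => mul_nonneg (by positivity) (qsym_recips_nonneg M v)
  have hale : ∀ M, a M ≤ harm M ^ v.length / ((M : ℝ) + 1) ^ 2 := fun M => by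
    rw [ha, div_eq_inv_mul, ← inv_pow]
    refine mul_le_mul ?_ (qsym_recips_le M hv) (qsym_recips_nonneg M v) (by positivity)
    exact pow_le_pow_of_le_one (by positivity) (inv_le_one_of_one_le₀ (by simp)) hk
  have hsum : Summable a := Summable.of_nonneg_of_le ha0 hale (summable_harm_pow_div_sq _)
  have hq : ∀ M, qsym (recips M) (v ++ [k]) = ∑ i ∈ Finset.range M, a i := fun M => by
    induction M with
    | zero => simp [recips]
    | succ M ih => rw [qsym_recips_succ_append_singleton, ih, Finset.sum_range_succ]
  refine ⟨∑' i, a i, fun n => ?_⟩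
  have hs := summable_harm_pow_div_sq (v.length + n)
  have ht := tendsto_sum_nat_add fun M : ℕ => harm M ^ (v.length + n) / ((M : ℝ) + 1) ^ 2
  rw [← neg_zero]
  have hmain : Tendsto (fun M => (∑' i, a (i + M)) * harm M ^ n) atTop (𝓝 0) := by
    refine squeeze_zero (fun M => mul_nonneg (tsum_nonneg fun i => ha0 _)
      (pow_nonneg (harm_nonneg M) n)) (fun M => ?_) ht
    rw [← tsum_mul_right]
    refine Summable.tsum_le_tsum (fun i => ?_)
      (((summable_nat_add_iff M).2 hsum).mul_right _)
      ((summable_nat_add_iff (f := fun M : ℕ => harm M ^ (v.length + n) / ((M : ℝ) + 1) ^ 2) M).2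
        hs)
    calc a (i + M) * harm M ^ n
        ≤ harm (i + M) ^ v.length / (((i + M : ℕ) : ℝ) + 1) ^ 2 * harm (i + M) ^ n := by
          have := harm_nonneg (i + M)
          exact mul_le_mul (hale _) (pow_le_pow_left₀ (harm_nonneg M) (harm_mono (by omega)) n)
            (pow_nonneg (harm_nonneg M) n) (by positivity)
      _ = _ := by rw [pow_add]; ring
  refine hmain.neg.congr fun M => ?_
  simp only [hq]
  rw [← hsum.sum_add_tsum_nat_add M]
  ring

lemma sum_filter_strictMono_eq_qsym (n A : ℕ) (w : List ℕ) :
    ∑ f ∈ (Fintype.piFinset fun _ : Fin w.length => Finset.Ioc A (A + n)).filter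
        (fun f => StrictMono f), ∏ i, ((f i : ℝ)⁻¹) ^ w.get i =
      qsym ((List.range n).map fun i : ℕ => (((A + i + 1 : ℕ) : ℝ))⁻¹) w := by
  classical
  induction n generalizing A w with
  | zero =>
    cases w with
    | nil =>
      have h : (Fintype.piFinset fun _ : Fin ([] : List ℕ).length => Finset.Ioc A (A + 0)).filter
          (fun f => StrictMono f) = {fun i => i.elim0} := by
        ext f
        simp only [Finset.mem_filter, Fintype.mem_piFinset, Finset.mem_singleton]
        exact ⟨fun _ => funext fun i => i.elim0,
          fun _ => ⟨fun i => i.elim0, fun i => i.elim0⟩⟩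
      rw [h]
      simp
    | cons k w =>
      simp only [List.range_zero, List.map_nil, qsym_nil_cons]
      refine Finset.sum_eq_zero fun f hf => ?_
      have := Fintype.mem_piFinset.1 (Finset.mem_filter.1 hf).1 ⟨0, by simp⟩
      simp at this
  | succ n ih =>
    cases w with
    | nil =>
      have h : (Fintype.piFinset fun _ : Fin ([] : List ℕ).length =>
          Finset.Ioc A (A + (n + 1))).filter (fun f => StrictMono f) = {fun i => i.elim0} := by
        ext f
        simp only [Finset.mem_filter, Fintype.mem_piFinset, Finset.mem_singleton]
        exact ⟨fun _ => funext fun i => i.elim0,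
          fun _ => ⟨fun i => i.elim0, fun i => i.elim0⟩⟩
      rw [h]
      simp
    | cons k w =>
      have hl : (List.range (n + 1)).map (fun i : ℕ => (((A + i + 1 : ℕ) : ℝ))⁻¹) =
          ((A + 1 : ℕ) : ℝ)⁻¹ :: (List.range n).map
            (fun i : ℕ => (((A + 1 + i + 1 : ℕ) : ℝ))⁻¹) := by
        rw [List.range_succ_eq_map, List.map_cons, List.map_map]
        congr 1
        refine List.map_congr_left fun i _ => ?_
        simp only [Function.comp_apply]
        congr 2
        omega
      rw [hl, qsym_cons_cons, ← ih (A + 1) (k :: w), ← ih (A + 1) w]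
      refine (Finset.sum_filter_add_sum_filter_not _
          (fun f : Fin (w.length + 1) → ℕ => f 0 = A + 1) _).symm.trans ((add_comm _ _).trans ?_)
      congr 1
      · refine Finset.sum_congr ?_ fun _ _ => rfl
        ext f
        simp only [Finset.mem_filter, Fintype.mem_piFinset, Finset.mem_Ioc]
        constructor
        · rintro ⟨⟨h1, h2⟩, h3⟩
          refine ⟨fun i => ?_, h2⟩
          have h4 := h2.monotone (Fin.zero_le i)
          have h5 := h1 0
          have h6 := h1 i
          have h3' : f 0 ≠ A + 1 := h3
          omega
        · rintro ⟨h1, h2⟩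
          refine ⟨⟨fun i => ?_, h2⟩, ?_⟩
          · have := h1 i; omega
          · have := h1 0
            intro h
            omega
      · rw [Finset.mul_sum]
        refine Finset.sum_nbij' (fun f : Fin (w.length + 1) → ℕ => Fin.tail f)
          (fun f => (Fin.cons (A + 1) f : Fin (w.length + 1) → ℕ)) ?_ ?_ ?_ ?_ ?_
        · intro f hf
          simp only [Finset.mem_filter, Fintype.mem_piFinset, Finset.mem_Ioc] at hf ⊢
          obtain ⟨⟨h1, h2⟩, h3⟩ := hf
          have h3' : f 0 = A + 1 := h3
          refine ⟨fun i => ?_, fun i j hij => h2 (Fin.succ_lt_succ_iff.2 hij)⟩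
          have h4 := h2 (Fin.succ_pos i)
          have h5 := h1 i.succ
          simp only [Fin.tail]
          omega
        · intro f hf
          simp only [Finset.mem_filter, Fintype.mem_piFinset, Finset.mem_Ioc] at hf ⊢
          obtain ⟨h1, h2⟩ := hf
          refine ⟨⟨fun i => ?_, ?_⟩, rfl⟩
          · refine Fin.cases ?_ (fun j => ?_) i
            · simp
            · have := h1 j
              simp only [Fin.cons_succ]
              omega
          · intro i j
            refine Fin.cases ?_ (fun i => ?_) i
            · refine Fin.cases ?_ (fun j => ?_) j
              · intro h; exact absurd h (lt_irrefl _)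
              · intro _
                have := h1 j
                simp only [Fin.cons_zero, Fin.cons_succ]
                omega
            · refine Fin.cases ?_ (fun j => ?_) j
              · intro h; exact absurd h (Fin.not_lt_zero _)
              · intro h
                simpa using h2 (Fin.succ_lt_succ_iff.1 h)
        · intro f hf
          have h3 : f 0 = A + 1 := (Finset.mem_filter.1 hf).2
          simp only [← h3]
          exact Fin.cons_self_tail f
        · intro f hf
          exact Fin.tail_cons _ _
        · intro f hf
          have h3 : f 0 = A + 1 := (Finset.mem_filter.1 hf).2
          have h4 := Fin.prod_univ_succ
            (fun i : Fin (w.length + 1) => ((f i : ℝ)⁻¹) ^ (k :: w).get i)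
          refine h4.trans ?_
          rw [h3]
          rfl

lemma MZV_eq_of_tendsto {w : List ℕ} {l : ℝ}
    (h : Tendsto (fun M => qsym (recips M) w) atTop (𝓝 l)) : MZV w = l := by
  classical
  set g : {f : Fin w.length → ℕ+ // StrictMono f} → ℝ :=
    fun m => ∏ i, 1 / ((m.1 i : ℕ) : ℝ) ^ w.get i with hg
  have hg0 : ∀ m, 0 ≤ g m := fun m => Finset.prod_nonneg fun i _ => by positivity
  have hfin : ∀ M : ℕ, {m : {f : Fin w.length → ℕ+ // StrictMono f} |
      ∀ i, (m.1 i : ℕ) ≤ M}.Finite := fun M => by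
    refine Set.Finite.of_injOn (f := fun m i => (m.1 i : ℕ))
      (t := ↑(Fintype.piFinset fun _ : Fin w.length => Finset.Ioc 0 M)) ?_ ?_
      (Finset.finite_toSet _)
    · intro m hm
      simp only [Finset.mem_coe, Fintype.mem_piFinset, Finset.mem_Ioc]
      exact fun i => ⟨(m.1 i).pos, hm i⟩
    · intro m _ m' _ hmm
      exact Subtype.ext (funext fun i => PNat.coe_injective (congrFun hmm i))
  set s : ℕ → Finset {f : Fin w.length → ℕ+ // StrictMono f} := fun M => (hfin M).toFinset
  have hs : ∀ M, ∑ m ∈ s M, g m = qsym (recips M) w := fun M => by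
    have h1 := sum_filter_strictMono_eq_qsym M 0 w
    have h2 : (List.range M).map (fun i : ℕ => (((0 + i + 1 : ℕ) : ℝ))⁻¹) = recips M := by
      simp [recips]
    rw [h2] at h1
    rw [← h1]
    refine Finset.sum_bij (fun m _ i => (m.1 i : ℕ)) ?_ ?_ ?_ ?_
    · intro m hm
      have hm' : ∀ i, (m.1 i : ℕ) ≤ M := (hfin M).mem_toFinset.1 hm
      simp only [Finset.mem_filter, Fintype.mem_piFinset, Finset.mem_Ioc]
      exact ⟨fun i => ⟨(m.1 i).pos, by simpa using hm' i⟩, fun i j hij => m.2 hij⟩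
    · intro m _ m' _ hmm
      exact Subtype.ext (funext fun i => PNat.coe_injective (congrFun hmm i))
    · intro f hf
      simp only [Finset.mem_filter, Fintype.mem_piFinset, Finset.mem_Ioc] at hf
      refine ⟨⟨fun i => ⟨f i, (hf.1 i).1⟩, fun i j hij => hf.2 hij⟩, ?_, rfl⟩
      refine (hfin M).mem_toFinset.2 fun i => ?_
      simpa using (hf.1 i).2
    · intro m _
      simp [hg]
  have hmono : Monotone s := fun M N hMN m hm =>
    (hfin N).mem_toFinset.2 fun i => ((hfin M).mem_toFinset.1 hm i).trans hMN
  have hcov : Tendsto s atTop atTop := by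
    refine tendsto_atTop_finset_of_monotone hmono fun m => ?_
    refine ⟨∑ i, (m.1 i : ℕ), (hfin _).mem_toFinset.2 fun i => ?_⟩
    exact Finset.single_le_sum (f := fun i => (m.1 i : ℕ)) (fun _ _ => Nat.zero_le _)
      (Finset.mem_univ i)
  have hsl : Tendsto (fun M => ∑ m ∈ s M, g m) atTop (𝓝 l) := by simpa only [hs] using h
  have hbd : ∀ u : Finset _, ∑ m ∈ u, g m ≤ l := fun u => by
    have hmon : Monotone fun M => ∑ m ∈ s M, g m := fun M N hMN =>
      Finset.sum_le_sum_of_subset_of_nonneg (hmono hMN) fun _ _ _ => hg0 _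
    obtain ⟨M, hM⟩ := (hcov.eventually (eventually_ge_atTop u)).exists
    exact (Finset.sum_le_sum_of_subset_of_nonneg hM fun _ _ _ => hg0 _).trans
      (hmon.ge_of_tendsto hsl M)
  have hsum : Summable g := summable_of_sum_le hg0 hbd
  exact tendsto_nhds_unique (hsum.hasSum.comp hcov) hsl

/-- Pairs consisting of a number and a sequence, both given by the same polynomial in `T` and in
the harmonic numbers respectively, the latter up to a negligible error. -/
noncomputable def regPairs (T : ℝ) : Subalgebra ℝ (ℝ × (ℕ → ℝ)) where
  carrier := {x | ∃ p : Polynomial ℝ, x.1 = p.eval T ∧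
    Negligible fun M => x.2 M - p.eval (harm M)}
  mul_mem' := by
    rintro x y ⟨p, hp, hp'⟩ ⟨q, hq, hq'⟩
    refine ⟨p * q, by simp [hp, hq], ?_⟩
    have := ((hp'.mul hq').add (hp'.mul_eval q)).add (hq'.mul_eval p)
    refine (congrArg Negligible (funext fun M => ?_)).mp this
    simp only [Prod.snd_mul, Pi.mul_apply, Polynomial.eval_mul]
    ring
  add_mem' := by
    rintro x y ⟨p, hp, hp'⟩ ⟨q, hq, hq'⟩
    refine ⟨p + q, by simp [hp, hq], ?_⟩
    refine (congrArg Negligible (funext fun M => ?_)).mp (hp'.add hq')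
    simp only [Prod.snd_add, Pi.add_apply, Polynomial.eval_add]
    ring
  algebraMap_mem' c := by
    refine ⟨Polynomial.C c, by simp, ?_⟩
    refine (congrArg Negligible (funext fun M => ?_)).mp negligible_zero
    simp

lemma eq_zero_of_mem_regPairs {T : ℝ} {x : ℝ × (ℕ → ℝ)} (hx : x ∈ regPairs T)
    (h : Tendsto x.2 atTop (𝓝 0)) : x.1 = 0 := by
  obtain ⟨p, hp, hp'⟩ := hx
  have h1 : Tendsto (fun M => p.eval (harm M)) atTop (𝓝 0) := by
    simpa using h.sub hp'.tendsto
  rcases lt_or_ge 0 p.degree with hd | hd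
  · have h2 := (p.abs_tendsto_atTop hd).comp tendsto_harm_atTop
    exact absurd h1.abs (not_tendsto_nhds_of_tendsto_atTop h2 _)
  · rw [Polynomial.eq_C_of_degree_le_zero hd] at h1 hp
    simp only [Polynomial.eval_C] at h1 hp
    rw [hp]
    exact tendsto_nhds_unique tendsto_const_nhds h1

end Truncation

section Regularization

open Filter Topology

/-- Words that end with at most `r` ones after a nonempty admissible prefix. -/
def AdmThenOnes (r : ℕ) (l : List ℕ) : Prop :=
  (∀ i ∈ l, 0 < i) ∧ ∃ (w : List ℕ) (k s : ℕ), 2 ≤ k ∧ s ≤ r ∧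
    l = w ++ [k] ++ List.replicate s 1

lemma AdmThenOnes.cons {r : ℕ} {l : List ℕ} (h : AdmThenOnes r l) {a : ℕ} (ha : 0 < a) :
    AdmThenOnes r (a :: l) := by
  obtain ⟨hp, w, k, s, hk, hs, rfl⟩ := h
  refine ⟨fun i hi => ?_, a :: w, k, s, hk, hs, rfl⟩
  rcases List.mem_cons.1 hi with rfl | hi
  · exact ha
  · exact hp i hi

lemma AdmThenOnes.mono {r r' : ℕ} (hr : r ≤ r') {l : List ℕ} (h : AdmThenOnes r l) :
    AdmThenOnes r' l := by
  obtain ⟨hp, w, k, s, hk, hs, rfl⟩ := h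
  exact ⟨hp, w, k, s, hk, hs.trans hr, rfl⟩

lemma admThenOnes_cons_replicate {k r : ℕ} (hk : 2 ≤ k) :
    AdmThenOnes r (k :: List.replicate r 1) := by
  refine ⟨fun i hi => ?_, [], k, r, hk, le_rfl, rfl⟩
  rcases List.mem_cons.1 hi with rfl | hi
  · omega
  · rw [List.eq_of_mem_replicate hi]; exact one_pos

lemma stuffle_nil_right (u : List ℕ) : stuffle u [] = {u} := by
  cases u <;> simp [stuffle]

lemma stuffle_nil_left (u : List ℕ) : stuffle [] u = {u} := by
  cases u <;> simp [stuffle]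

lemma stuffle_one_cons (b : ℕ) (v : List ℕ) :
    stuffle [1] (b :: v) = {1 :: b :: v} + (stuffle [1] v).map (b :: ·) + {(1 + b) :: v} := by
  rw [stuffle, stuffle_nil_left, stuffle_nil_left, Multiset.map_singleton, Multiset.map_singleton]

lemma exists_stuffle_one_replicate (r : ℕ) :
    ∃ B : Multiset (List ℕ), stuffle [1] (List.replicate r 1) =
      (r + 1) • {List.replicate (r + 1) 1} + B ∧ ∀ l ∈ B, AdmThenOnes r l := by
  induction r with
  | zero => exact ⟨0, by simp [stuffle_nil_right], by simp⟩
  | succ r ih =>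
    obtain ⟨B, hB, h⟩ := ih
    refine ⟨B.map (1 :: ·) + {2 :: List.replicate r 1}, ?_, ?_⟩
    · rw [List.replicate_succ, stuffle_one_cons, hB, Multiset.map_add, Multiset.map_nsmul,
        Multiset.map_singleton, ← List.replicate_succ, ← List.replicate_succ,
        succ_nsmul (n := r + 1)]
      abel
    · intro l hl
      rcases Multiset.mem_add.1 hl with hl | hl
      · obtain ⟨l', hl', rfl⟩ := Multiset.mem_map.1 hl
        exact ((h l' hl').mono (Nat.le_succ r)).cons one_pos
      · rw [Multiset.mem_singleton.1 hl]
        exact (admThenOnes_cons_replicate le_rfl).mono (Nat.le_succ r)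

lemma exists_stuffle_one_append {w : List ℕ} (hw : ∀ i ∈ w, 0 < i) {k : ℕ} (hk : 2 ≤ k) (r : ℕ) :
    ∃ B : Multiset (List ℕ), stuffle [1] (w ++ [k] ++ List.replicate r 1) =
      (r + 1) • {w ++ [k] ++ List.replicate (r + 1) 1} + B ∧ ∀ l ∈ B, AdmThenOnes r l := by
  induction w with
  | nil =>
    obtain ⟨B, hB, h⟩ := exists_stuffle_one_replicate r
    refine ⟨{1 :: k :: List.replicate r 1} + B.map (k :: ·) + {(1 + k) :: List.replicate r 1},
      ?_, ?_⟩
    · simp only [List.nil_append, List.cons_append]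
      rw [stuffle_one_cons, hB, Multiset.map_add, Multiset.map_nsmul, Multiset.map_singleton]
      abel
    · intro l hl
      rcases Multiset.mem_add.1 hl with hl | hl
      · rcases Multiset.mem_add.1 hl with hl | hl
        · rw [Multiset.mem_singleton.1 hl]
          exact (admThenOnes_cons_replicate hk).cons one_pos
        · obtain ⟨l', hl', rfl⟩ := Multiset.mem_map.1 hl
          exact (h l' hl').cons (by omega)
      · rw [Multiset.mem_singleton.1 hl]
        exact admThenOnes_cons_replicate (by omega)
  | cons a w ih =>
    have ha : 0 < a := hw a (by simp)
    have hw' : ∀ i ∈ w, 0 < i := fun i hi => hw i (by simp [hi])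
    obtain ⟨B, hB, h⟩ := ih hw'
    have hadm : AdmThenOnes r (w ++ [k] ++ List.replicate r 1) := by
      refine ⟨fun i hi => ?_, w, k, r, hk, le_rfl, rfl⟩
      rcases List.mem_append.1 hi with hi | hi
      · rcases List.mem_append.1 hi with hi | hi
        · exact hw' i hi
        · rw [List.mem_singleton.1 hi]; omega
      · rw [List.eq_of_mem_replicate hi]; exact one_pos
    refine ⟨{1 :: a :: (w ++ [k] ++ List.replicate r 1)} + B.map (a :: ·) +
      {(1 + a) :: (w ++ [k] ++ List.replicate r 1)}, ?_, ?_⟩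
    · simp only [List.cons_append] at hB ⊢
      rw [stuffle_one_cons, hB, Multiset.map_add, Multiset.map_nsmul, Multiset.map_singleton]
      abel
    · intro l hl
      rcases Multiset.mem_add.1 hl with hl | hl
      · rcases Multiset.mem_add.1 hl with hl | hl
        · rw [Multiset.mem_singleton.1 hl]
          exact (hadm.cons ha).cons one_pos
        · obtain ⟨l', hl', rfl⟩ := Multiset.mem_map.1 hl
          exact (h l' hl').cons ha
      · rw [Multiset.mem_singleton.1 hl]
        exact hadm.cons (by omega)

variable {Z : List ℕ → ℝ}

/-- A word function `Z` together with the truncated sums of the same word. -/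
noncomputable def zpair (Z : List ℕ → ℝ) (l : List ℕ) : ℝ × (ℕ → ℝ) :=
  (Z l, fun M => qsym (recips M) l)

lemma zpair_mul (hZ : IsStuffleReg Z) {u v : List ℕ} (hu : ∀ i ∈ u, 0 < i)
    (hv : ∀ i ∈ v, 0 < i) :
    zpair Z u * zpair Z v = ((stuffle u v).map (zpair Z)).sum := by
  have h1 : ∀ s : Multiset (List ℕ), (s.map (zpair Z)).sum =
      ((s.map Z).sum, fun M => (s.map (qsym (recips M))).sum) := fun s => by
    induction s using Multiset.induction_on with
    | empty => rfl
    | cons a s ih => simp only [Multiset.map_cons, Multiset.sum_cons, ih]; rfl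
  rw [h1]
  ext1
  · exact hZ.mul u v hu hv
  · exact funext fun M => qsym_mul (recips M) u v

lemma zpair_nil_mem (hZ : IsStuffleReg Z) (T : ℝ) : zpair Z [] ∈ regPairs T := by
  have : zpair Z [] = 1 := by
    ext1
    · exact hZ.empty
    · exact funext fun M => by simp [zpair]
  rw [this]
  exact one_mem _

lemma zpair_one_mem : zpair Z [1] ∈ regPairs (Z [1]) := by
  refine ⟨Polynomial.X, by simp [zpair], ?_⟩
  refine (congrArg Negligible (funext fun M => ?_)).mp negligible_zero
  simp [zpair, qsym_recips_one]

lemma zpair_admissible_mem (hZ : IsStuffleReg Z) {w : List ℕ} {k : ℕ}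
    (hw : ∀ i ∈ w ++ [k], 0 < i) (hk : 2 ≤ k) (T : ℝ) : zpair Z (w ++ [k]) ∈ regPairs T := by
  obtain ⟨l, hl⟩ := exists_negligible_of_getLast (v := w) (fun i hi => hw i (by simp [hi])) hk
  have h1 : MZV (w ++ [k]) = l := by
    refine MZV_eq_of_tendsto ?_
    simpa using hl.tendsto.add_const l
  refine ⟨Polynomial.C l, ?_, ?_⟩
  · rw [Polynomial.eval_C, ← h1]
    exact hZ.conv _ hw (by simpa using hk)
  · simpa [zpair] using hl

lemma mem_of_stuffle_one (hZ : IsStuffleReg Z) {v x : List ℕ} (hv : ∀ i ∈ v, 0 < i) {r : ℕ}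
    {B : Multiset (List ℕ)} (hB : stuffle [1] v = (r + 1) • {x} + B)
    (h : ∀ l ∈ B, zpair Z l ∈ regPairs (Z [1])) (hvm : zpair Z v ∈ regPairs (Z [1])) :
    zpair Z x ∈ regPairs (Z [1]) := by
  have h1 := zpair_mul hZ (u := [1]) (by simp) hv
  rw [hB, Multiset.map_add, Multiset.sum_add, Multiset.map_nsmul, Multiset.sum_nsmul,
    Multiset.map_singleton, Multiset.sum_singleton] at h1
  have h2 : (r + 1) • zpair Z x ∈ regPairs (Z [1]) := by
    rw [← sub_eq_iff_eq_add] at h1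
    rw [← h1]
    refine sub_mem (mul_mem zpair_one_mem hvm) (multiset_sum_mem _ fun y hy => ?_)
    obtain ⟨l, hl, rfl⟩ := Multiset.mem_map.1 hy
    exact h l hl
  have h3 := (regPairs (Z [1])).smul_mem h2 (((r + 1 : ℕ) : ℝ)⁻¹)
  rwa [← Nat.cast_smul_eq_nsmul ℝ, smul_smul, inv_mul_cancel₀ (by positivity), one_smul] at h3

lemma zpair_mem_of_admThenOnes (hZ : IsStuffleReg Z) (r : ℕ) (l : List ℕ)
    (hl : AdmThenOnes r l) : zpair Z l ∈ regPairs (Z [1]) := by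
  induction r generalizing l with
  | zero =>
    obtain ⟨hp, w, k, s, hk, hs, rfl⟩ := hl
    obtain rfl : s = 0 := by omega
    simp only [List.replicate_zero, List.append_nil] at hp ⊢
    exact zpair_admissible_mem hZ hp hk _
  | succ r ih =>
    obtain ⟨hp, w, k, s, hk, hs, rfl⟩ := hl
    rcases Nat.lt_or_ge s (r + 1) with h | h
    · exact ih _ ⟨hp, w, k, s, hk, by omega, rfl⟩
    · obtain rfl : s = r + 1 := by omega
      have hw : ∀ i ∈ w, 0 < i := fun i hi => hp i (by simp [hi])
      obtain ⟨B, hB, hB'⟩ := exists_stuffle_one_append hw hk r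
      have hadm : AdmThenOnes r (w ++ [k] ++ List.replicate r 1) := by
        refine ⟨fun i hi => hp i ?_, w, k, r, hk, le_rfl, rfl⟩
        rw [List.replicate_succ', ← List.append_assoc]
        exact List.mem_append_left _ hi
      exact mem_of_stuffle_one hZ hadm.1 hB (fun l hl => ih l (hB' l hl)) (ih _ hadm)

lemma zpair_replicate_mem (hZ : IsStuffleReg Z) (r : ℕ) :
    zpair Z (List.replicate r 1) ∈ regPairs (Z [1]) := by
  induction r with
  | zero => exact zpair_nil_mem hZ _
  | succ r ih =>
    obtain ⟨B, hB, hB'⟩ := exists_stuffle_one_replicate r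
    refine mem_of_stuffle_one hZ (fun i hi => ?_) hB
      (fun l hl => zpair_mem_of_admThenOnes hZ r l (hB' l hl)) ih
    rw [List.eq_of_mem_replicate hi]; exact one_pos

lemma exists_eq_append_replicate (l : List ℕ) (hl : ∀ i ∈ l, 0 < i) :
    (∃ r, l = List.replicate r 1) ∨ ∃ r, AdmThenOnes r l := by
  induction l with
  | nil => exact Or.inl ⟨0, rfl⟩
  | cons a l ih =>
    have ha : 0 < a := hl a (by simp)
    rcases ih fun i hi => hl i (by simp [hi]) with ⟨r, rfl⟩ | ⟨r, h⟩
    · rcases Nat.lt_or_ge a 2 with h | h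
      · obtain rfl : a = 1 := by omega
        exact Or.inl ⟨r + 1, rfl⟩
      · exact Or.inr ⟨r, admThenOnes_cons_replicate h⟩
    · exact Or.inr ⟨r, h.cons ha⟩

lemma zpair_mem (hZ : IsStuffleReg Z) {l : List ℕ} (hl : ∀ i ∈ l, 0 < i) :
    zpair Z l ∈ regPairs (Z [1]) := by
  rcases exists_eq_append_replicate l hl with ⟨r, rfl⟩ | ⟨r, h⟩
  · exact zpair_replicate_mem hZ r
  · exact zpair_mem_of_admThenOnes hZ r l h

lemma pos_of_mem_contractions {l c : List ℕ} (hl : ∀ i ∈ l, 0 < i) (hc : c ∈ contractions l) :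
    ∀ i ∈ c, 0 < i := by
  induction l using contractions.induct generalizing c with
  | case1 => simp_all [contractions]
  | case2 a => simp_all [contractions]
  | case3 a b t ih1 ih2 =>
    rw [contractions] at hc
    rcases Multiset.mem_add.1 hc with hc | hc
    · obtain ⟨c', hc', rfl⟩ := Multiset.mem_map.1 hc
      intro i hi
      rcases List.mem_cons.1 hi with rfl | hi
      · exact hl _ (by simp)
      · exact ih1 (fun i hi => hl i (by simp [List.mem_cons.1 hi])) hc' i hi
    · refine ih2 (fun i hi => ?_) hc
      rcases List.mem_cons.1 hi with rfl | hi
      · have := hl a (by simp)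
        omega
      · exact hl i (by simp [hi])

lemma zetaStar_pair_mem (hZ : IsStuffleReg Z) {l : List ℕ} (hl : ∀ i ∈ l, 0 < i) :
    ((zetaStarOf Z l, fun M => qsymStar (recips M) l) : ℝ × (ℕ → ℝ)) ∈ regPairs (Z [1]) := by
  have h1 : ∀ s : Multiset (List ℕ), (s.map (zpair Z)).sum =
      ((s.map Z).sum, fun M => (s.map (qsym (recips M))).sum) := fun s => by
    induction s using Multiset.induction_on with
    | empty => rfl
    | cons a s ih => simp only [Multiset.map_cons, Multiset.sum_cons, ih]; rfl
  have h2 := h1 (contractions l)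
  simp only [zetaStarOf, qsymStar]
  rw [← h2]
  refine multiset_sum_mem _ fun y hy => ?_
  obtain ⟨c, hc, rfl⟩ := Multiset.mem_map.1 hy
  exact zpair_mem hZ (pos_of_mem_contractions hl hc)

lemma zetaA_pair_mem (hZ : IsStuffleReg Z) (a : ℕ) {l : List ℕ} (hl : ∀ i ∈ l, 0 < i) :
    ((zetaA Z a l, fun M => zetaA (qsym (recips M)) a l) : ℝ × (ℕ → ℝ)) ∈ regPairs (Z [1]) := by
  have h : ((zetaA Z a l, fun M => zetaA (qsym (recips M)) a l) : ℝ × (ℕ → ℝ)) =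
      (-1 : ℝ) ^ a • ∑ f ∈ (Fintype.piFinset fun _ : Fin l.length =>
        Finset.range (a + 1)).filter (fun f => ∑ i, f i = a),
        (∏ i, (Nat.choose (l.get i - 1 + f i) (f i) : ℝ)) •
          zpair Z (List.ofFn fun i => l.get i + f i) := by
    ext1
    · simp [zetaA, zpair, Prod.fst_sum, mul_comm]
    · ext M
      simp [zetaA, zpair, Prod.snd_sum, mul_comm]
  rw [h]
  refine (regPairs (Z [1])).smul_mem (sum_mem fun f _ => (regPairs (Z [1])).smul_mem
    (zpair_mem hZ fun i hi => ?_) _) _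
  obtain ⟨j, rfl⟩ := (List.mem_ofFn' _ _).1 hi
  exact Nat.add_pos_left (hl (l.get j) (List.get_mem _ _)) _

/-- The antipode relation between star and non-star values. -/
lemma sum_zetaStar_mul_reverse (hZ : IsStuffleReg Z) (l : List ℕ) (hne : l ≠ [])
    (hl : ∀ i ∈ l, 0 < i) :
    ∑ i ∈ Finset.range (l.length + 1),
      (-1) ^ i * zetaStarOf Z (l.take i) * Z (l.drop i).reverse = 0 := by
  have hmem : (∑ i ∈ Finset.range (l.length + 1), (-1 : ℝ) ^ i •
      (((zetaStarOf Z (l.take i), fun M => qsymStar (recips M) (l.take i)) : ℝ × (ℕ → ℝ)) *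
        zpair Z (l.drop i).reverse)) ∈ regPairs (Z [1]) := by
    refine sum_mem fun i _ => (regPairs (Z [1])).smul_mem (mul_mem (zetaStar_pair_mem hZ fun j hj =>
      hl j (List.mem_of_mem_take hj)) (zpair_mem hZ fun j hj => ?_)) _
    exact hl j (List.mem_of_mem_drop (List.mem_reverse.1 hj))
  have h0 := eq_zero_of_mem_regPairs hmem ?_
  · simpa [Prod.fst_sum, zpair, mul_assoc] using h0
  · obtain ⟨k, w, rfl⟩ := List.exists_cons_of_ne_nil hne
    refine tendsto_const_nhds.congr fun M => ?_
    have := sum_qsymStar_mul_qsym_reverse (recips M) k w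
    rw [← this]
    simp [Prod.snd_sum, zpair, mul_assoc]

end Regularization

section ZetaA

lemma zetaA_eq_antidiagonalTuple (Z : List ℕ → ℝ) (a : ℕ) (l : List ℕ) :
    zetaA Z a l = (-1 : ℝ) ^ a * ∑ f ∈ Finset.Nat.antidiagonalTuple l.length a,
      Z (List.ofFn fun i => l.get i + f i) *
        ∏ i, (Nat.choose (l.get i - 1 + f i) (f i) : ℝ) := by
  rw [zetaA]
  congr 1
  refine Finset.sum_congr ?_ fun _ _ => rfl
  ext f
  simp only [Finset.mem_filter, Fintype.mem_piFinset, Finset.mem_range,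
    Finset.Nat.mem_antidiagonalTuple, and_iff_right_iff_imp]
  rintro rfl i
  exact Nat.lt_succ_of_le
    (Finset.single_le_sum (f := f) (fun _ _ => Nat.zero_le _) (Finset.mem_univ i))

lemma zetaA_nil (Z : List ℕ → ℝ) (a : ℕ) : zetaA Z a [] = if a = 0 then Z [] else 0 := by
  rw [zetaA_eq_antidiagonalTuple]
  cases a with
  | zero => simp
  | succ a => simp [Finset.Nat.antidiagonalTuple_zero_succ]

lemma zetaA_cons (Z : List ℕ → ℝ) (a k : ℕ) (w : List ℕ) :
    zetaA Z a (k :: w) = ∑ x ∈ Finset.HasAntidiagonal.antidiagonal a,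
      (-1 : ℝ) ^ x.1 * (Nat.choose (k - 1 + x.1) x.1 : ℝ) *
        zetaA (fun v => Z ((k + x.1) :: v)) x.2 w := by
  simp only [zetaA_eq_antidiagonalTuple, Finset.mul_sum]
  rw [Finset.sum_sigma']
  refine Finset.sum_nbij'
    (fun f : Fin (w.length + 1) → ℕ =>
      (⟨(f 0, ∑ i, Fin.tail f i), Fin.tail f⟩ : (_ : ℕ × ℕ) × (Fin w.length → ℕ)))
    (fun y => (Fin.cons y.1.1 y.2 : Fin (w.length + 1) → ℕ)) ?_ ?_ ?_ ?_ ?_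
  · intro f hf
    have hf' : ∑ i : Fin (w.length + 1), f i = a := Finset.Nat.mem_antidiagonalTuple.1 hf
    rw [Fin.sum_univ_succ] at hf'
    simp only [Finset.mem_sigma, Finset.HasAntidiagonal.mem_antidiagonal,
      Finset.Nat.mem_antidiagonalTuple,
      and_true]
    exact hf'
  · rintro ⟨⟨b, c⟩, g⟩ hg
    simp only [Finset.mem_sigma, Finset.HasAntidiagonal.mem_antidiagonal,
      Finset.Nat.mem_antidiagonalTuple] at hg
    refine Finset.Nat.mem_antidiagonalTuple.2 ?_
    refine (Fin.sum_univ_succ (n := w.length) _).trans ?_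
    simp [hg.1, hg.2]
  · intro f _
    exact Fin.cons_self_tail f
  · rintro ⟨⟨b, c⟩, g⟩ hg
    simp only [Finset.mem_sigma, Finset.HasAntidiagonal.mem_antidiagonal,
      Finset.Nat.mem_antidiagonalTuple] at hg
    simp [Fin.tail_cons, hg.2]
  · intro f hf
    have hf' : ∑ i : Fin (w.length + 1), f i = a := Finset.Nat.mem_antidiagonalTuple.1 hf
    rw [Fin.sum_univ_succ] at hf'
    have h1 : (∏ i : Fin (w.length + 1), (Nat.choose ((k :: w).get i - 1 + f i) (f i) : ℝ)) =
        (Nat.choose (k - 1 + f 0) (f 0) : ℝ) *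
        ∏ i : Fin w.length, (Nat.choose (w.get i - 1 + f i.succ) (f i.succ) : ℝ) :=
      Fin.prod_univ_succ _
    have h2 : (List.ofFn fun i : Fin (w.length + 1) => (k :: w).get i + f i) =
        (k + f 0) :: List.ofFn fun i : Fin w.length => w.get i + f i.succ := List.ofFn_succ
    refine (congrArg₂ (fun x y => (-1 : ℝ) ^ a * (Z x * y)) h2 h1).trans ?_
    rw [← hf', pow_add]
    simp only [Fin.tail]
    ring

lemma zetaA_add (Z Z' : List ℕ → ℝ) (a : ℕ) (l : List ℕ) :
    zetaA (fun v => Z v + Z' v) a l = zetaA Z a l + zetaA Z' a l := by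
  simp only [zetaA, add_mul, Finset.sum_add_distrib, mul_add]

lemma zetaA_const_mul (c : ℝ) (Z : List ℕ → ℝ) (a : ℕ) (l : List ℕ) :
    zetaA (fun v => c * Z v) a l = c * zetaA Z a l := by
  simp only [zetaA, Finset.mul_sum]
  refine Finset.sum_congr rfl fun _ _ => by ring

lemma zetaA_zero (Z : List ℕ → ℝ) (l : List ℕ) : zetaA Z 0 l = Z l := by
  induction l generalizing Z with
  | nil => simp [zetaA_nil]
  | cons k w ih => simp [zetaA_cons, ih]

end ZetaA

section Series

open PowerSeries

lemma X_add_C_mul_inv {y : ℝ} (hy : y ≠ 0) : (X + C y : PowerSeries ℝ) * (X + C y)⁻¹ = 1 :=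
  PowerSeries.mul_inv_cancel _ (by simpa using hy)

lemma coeff_X_add_C_inv_pow {y : ℝ} (hy : y ≠ 0) {k : ℕ} (hk : 0 < k) (a : ℕ) :
    coeff a (((X + C y : PowerSeries ℝ)⁻¹) ^ k) =
      (-1) ^ a * (Nat.choose (k - 1 + a) a : ℝ) * y⁻¹ ^ (k + a) := by
  obtain ⟨k, rfl⟩ : ∃ k', k = k' + 1 := ⟨k - 1, by omega⟩
  have h0 : (X + C y : PowerSeries ℝ) * (PowerSeries.mk fun a => (-1) ^ a * y⁻¹ ^ (a + 1)) = 1 := by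
    ext n
    rw [add_mul, map_add, coeff_C_mul, coeff_mk, coeff_one]
    cases n with
    | zero => simp [hy]
    | succ n =>
      rw [coeff_succ_X_mul, coeff_mk]
      simp only [Nat.succ_ne_zero, if_false]
      have h := mul_inv_cancel₀ hy
      linear_combination (-(-1) ^ n * y⁻¹ ^ (n + 1)) * h
  have h1 : (X + C y : PowerSeries ℝ)⁻¹ = PowerSeries.mk fun a => (-1) ^ a * y⁻¹ ^ (a + 1) := by
    have h2 := X_add_C_mul_inv hy
    calc _ = (X + C y : PowerSeries ℝ)⁻¹ * ((X + C y : PowerSeries ℝ) *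
          (PowerSeries.mk fun a => (-1) ^ a * y⁻¹ ^ (a + 1))) := by rw [h0, mul_one]
      _ = _ := by rw [← mul_assoc, mul_comm _ (X + C y), h2, one_mul]
  have h3 : ((X + C y : PowerSeries ℝ)⁻¹) = C y⁻¹ * rescale (-y⁻¹) (invUnitsSub 1) := by
    rw [h1]
    ext n
    rw [coeff_mk, coeff_C_mul, coeff_rescale]
    simp only [coeff_invUnitsSub, one_divp, neg_pow y⁻¹]
    simp
    ring
  have h4 : (invUnitsSub 1 : PowerSeries ℝ) = PowerSeries.mk 1 := by
    ext n; simp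
  rw [h3, h4, mul_pow, ← map_pow, ← map_pow, mk_one_pow_eq_mk_choose_add, coeff_C_mul,
    coeff_rescale, coeff_mk, neg_pow y⁻¹, Nat.add_sub_cancel, Nat.add_comm k a,
    Nat.choose_symm_add, pow_add]
  ring

/-- Inverses of the linear forms `X + 1, …, X + q`. -/
noncomputable def posSer (q : ℕ) : List (PowerSeries ℝ) :=
  (List.range q).map fun i : ℕ => (X + C ((i : ℝ) + 1))⁻¹

/-- The truncated Hurwitz-type multiple zeta function, as a power series in the shift. -/
noncomputable def hurw (q : ℕ) (w : List ℕ) : PowerSeries ℝ := qsym (posSer q) w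

lemma coeff_qsym_inv (ys : List ℝ) (hys : ∀ y ∈ ys, y ≠ 0) (w : List ℕ) (hw : ∀ k ∈ w, 0 < k)
    (a : ℕ) :
    coeff a (qsym (ys.map fun y => (X + C y : PowerSeries ℝ)⁻¹) w) =
      zetaA (qsym (ys.map (·⁻¹))) a w := by
  induction ys generalizing w a with
  | nil =>
    cases w with
    | nil => simp [zetaA_nil, coeff_one]
    | cons k w =>
      simp only [List.map_nil, qsym_nil_cons, zetaA_cons]
      simp [zetaA]
  | cons y ys ih =>
    have hys' : ∀ y ∈ ys, y ≠ 0 := fun z hz => hys z (by simp [hz])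
    have hy : y ≠ 0 := hys y (by simp)
    cases w with
    | nil => simp [zetaA_nil, coeff_one]
    | cons k w =>
      have hw' : ∀ k ∈ w, 0 < k := fun z hz => hw z (by simp [hz])
      rw [List.map_cons, qsym_cons_cons, map_add, ih hys' _ hw, coeff_mul, zetaA_cons, zetaA_cons]
      simp only [List.map_cons, qsym_cons_cons, zetaA_add, zetaA_const_mul, mul_add,
        Finset.sum_add_distrib, ih hys' _ hw', coeff_X_add_C_inv_pow hy (hw k (by simp))]
      congr 1
      refine Finset.sum_congr rfl fun x _ => by ring

lemma coeff_hurw (q : ℕ) {w : List ℕ} (hw : ∀ k ∈ w, 0 < k) (a : ℕ) :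
    coeff a (hurw q w) = zetaA (qsym (recips q)) a w := by
  have h := coeff_qsym_inv ((List.range q).map fun i : ℕ => (i : ℝ) + 1) (fun y hy => by
    obtain ⟨i, -, rfl⟩ := List.mem_map.1 hy
    positivity) w hw a
  simpa [hurw, posSer, recips, Function.comp_def] using h

/-- The counterpart of `hurw` for the negative integers. -/
noncomputable def hurwNeg (p : ℕ) (w : List ℕ) : PowerSeries ℝ :=
  qsym ((List.range p).map fun i : ℕ => (X - C ((i : ℝ) + 1) : PowerSeries ℝ)⁻¹).reverse w

lemma hurwNeg_eq (p : ℕ) (w : List ℕ) :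
    hurwNeg p w = (-1) ^ w.sum * rescale (-1 : ℝ) (hurw p w.reverse) := by
  rw [hurw, map_qsym, ← List.sum_reverse w, ← qsym_map_mul, hurwNeg, ← qsym_reverse,
    List.reverse_reverse, posSer, List.map_map, List.map_map]
  congr 1
  refine List.map_congr_left fun i _ => ?_
  have hi : (i : ℝ) + 1 ≠ 0 := by positivity
  have h1 := congrArg (rescale (-1 : ℝ)) (X_add_C_mul_inv hi)
  rw [map_mul, map_add, rescale_X, map_one] at h1
  have h1' : rescale (-1 : ℝ) (C ((i : ℝ) + 1)) = C ((i : ℝ) + 1) := by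
    ext n
    rw [coeff_rescale, coeff_C]
    split_ifs with h <;> simp [h]
  rw [h1'] at h1
  simp only [Function.comp_apply]
  have h2 : (X - C ((i : ℝ) + 1) : PowerSeries ℝ) *
      (-1 * rescale (-1 : ℝ) (X + C ((i : ℝ) + 1))⁻¹) = 1 := by
    refine Eq.trans ?_ h1
    simp only [map_neg, map_one]
    ring
  have hi' : constantCoeff (X - C ((i : ℝ) + 1) : PowerSeries ℝ) ≠ 0 := by
    simp only [map_sub, constantCoeff_X, constantCoeff_C, zero_sub]
    exact neg_ne_zero.2 hi
  rw [eq_comm, PowerSeries.eq_inv_iff_mul_eq_one hi', mul_comm]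
  exact h2

lemma coeff_hurwNeg (p : ℕ) {w : List ℕ} (hw : ∀ k ∈ w, 0 < k) (a : ℕ) :
    coeff a (hurwNeg p w) =
      (-1) ^ (w.sum + a) * zetaA (qsym (recips p)) a w.reverse := by
  rw [hurwNeg_eq, show (-1 : PowerSeries ℝ) ^ w.sum = C ((-1 : ℝ) ^ w.sum) by simp, coeff_C_mul,
    coeff_rescale, coeff_hurw _ (fun k hk => hw k (List.mem_reverse.1 hk)), pow_add]
  ring

end Series

section Laurent

/-- The linear form `T + y` as a Laurent series in `T`. -/
noncomputable def linForm (y : ℝ) : LaurentSeries ℝ := HahnSeries.single 1 1 + HahnSeries.C y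

lemma coe_X_add_C (y : ℝ) :
    HahnSeries.ofPowerSeries ℤ ℝ (PowerSeries.X + PowerSeries.C y) = linForm y := by
  simp [linForm]

lemma coe_X_add_C_inv {y : ℝ} (hy : y ≠ 0) :
    HahnSeries.ofPowerSeries ℤ ℝ (PowerSeries.X + PowerSeries.C y)⁻¹ = (linForm y)⁻¹ := by
  rw [eq_comm, inv_eq_iff_eq_inv, eq_comm, inv_eq_iff_eq_inv]
  refine eq_inv_of_mul_eq_one_right ?_
  rw [← coe_X_add_C, ← map_mul, X_add_C_mul_inv hy, map_one]

lemma linForm_ne_zero (y : ℝ) : linForm y ≠ 0 := by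
  intro h
  have := congrArg (fun f : LaurentSeries ℝ => f.coeff 1) h
  simp [linForm, HahnSeries.C_apply] at this

lemma linForm_zero_inv_pow (c : ℕ) :
    ((linForm 0)⁻¹) ^ c = HahnSeries.single (-(c : ℤ)) (1 : ℝ) := by
  rw [linForm, map_zero, add_zero, HahnSeries.inv_single, HahnSeries.single_pow]
  simp

lemma coeff_linForm_inv_pow_neg {y : ℝ} (hy : y ≠ 0) (k : ℕ) {c : ℕ} (hc : 0 < c) :
    (((linForm y)⁻¹) ^ k).coeff (-(c : ℤ)) = 0 := by
  rw [← coe_X_add_C_inv hy, ← map_pow, PowerSeries.coeff_coe, if_pos (by omega)]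

lemma coeff_linForm_inv_pow_zero {y : ℝ} (hy : y ≠ 0) {k : ℕ} (hk : 0 < k) :
    (((linForm y)⁻¹) ^ k).coeff 0 = y⁻¹ ^ k := by
  rw [← coe_X_add_C_inv hy, ← map_pow, PowerSeries.coeff_coe, if_neg (by omega)]
  rw [Int.natAbs_zero, coeff_X_add_C_inv_pow hy hk]
  simp

lemma linForm_inv_mul (x y : ℝ) :
    HahnSeries.C (y - x) * ((linForm x)⁻¹ * (linForm y)⁻¹) = (linForm x)⁻¹ - (linForm y)⁻¹ := by
  have hx := linForm_ne_zero x
  have hy := linForm_ne_zero y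
  have h : (HahnSeries.C (y - x) : LaurentSeries ℝ) = linForm y - linForm x := by
    rw [linForm, linForm, add_sub_add_left_eq_sub, ← map_sub]
  rw [h]
  field_simp

lemma coe_mul_coeff_neg (P : PowerSeries ℝ) (f : LaurentSeries ℝ) (K : ℕ)
    (hf : ∀ n : ℕ, K < n → f.coeff (-(n : ℤ)) = 0) (c : ℕ) :
    (HahnSeries.ofPowerSeries ℤ ℝ P * f).coeff (-(c : ℤ)) =
      ∑ a ∈ Finset.range (K + 1), PowerSeries.coeff a P * f.coeff (-((c + a : ℕ) : ℤ)) := by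
  set F : PowerSeries ℝ := PowerSeries.mk fun n => f.coeff ((n : ℤ) - K) with hF
  have hf' : f = HahnSeries.single (-(K : ℤ)) (1 : ℝ) * HahnSeries.ofPowerSeries ℤ ℝ F := by
    ext n
    rw [HahnSeries.coeff_single_mul, one_mul, PowerSeries.coeff_coe]
    split_ifs with h
    · have := hf (-n).toNat (by omega)
      rwa [show -((-n).toNat : ℤ) = n by omega] at this
    · rw [hF, PowerSeries.coeff_mk]
      congr 1
      omega
  have h1 : (HahnSeries.ofPowerSeries ℤ ℝ P * f) =
      HahnSeries.single (-(K : ℤ)) (1 : ℝ) * HahnSeries.ofPowerSeries ℤ ℝ (P * F) := by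
    conv_lhs => rw [hf']
    rw [map_mul]
    ring
  rw [h1, HahnSeries.coeff_single_mul, one_mul, PowerSeries.coeff_coe]
  split_ifs with h
  · symm
    refine Finset.sum_eq_zero fun a _ => ?_
    rw [hf _ (by omega), mul_zero]
  · rw [PowerSeries.coeff_mul, Finset.Nat.sum_antidiagonal_eq_sum_range_succ_mk]
    refine (Finset.sum_subset_zero_on_sdiff ?_ ?_ ?_)
    · intro a ha
      rw [Finset.mem_range] at ha ⊢
      omega
    · intro a ha
      simp only [Finset.mem_sdiff, Finset.mem_range] at ha
      rw [hf _ (by omega), mul_zero]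
    · intro a ha
      rw [Finset.mem_range] at ha
      rw [hF, PowerSeries.coeff_mk]
      congr 2
      omega

/-- Inverses of `T - p, …, T - 1`. -/
noncomputable def negForms (p : ℕ) : List (LaurentSeries ℝ) :=
  ((List.range p).map fun i : ℕ => (linForm (-((i : ℝ) + 1)))⁻¹).reverse

/-- Inverses of `T + 1, …, T + q`. -/
noncomputable def posForms (q : ℕ) : List (LaurentSeries ℝ) :=
  (List.range q).map fun i : ℕ => (linForm ((i : ℝ) + 1))⁻¹

/-- The two-sided truncated multiple Hurwitz zeta function
`∑_{-p ≤ m₁ < ⋯ < m_d ≤ q} ∏ (T + m_i)^{-k_i}`. -/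
noncomputable def biHurw (w : List ℕ) (p q : ℕ) : LaurentSeries ℝ :=
  qsym (negForms p ++ (linForm 0)⁻¹ :: posForms q) w

/-- The coefficient of `T^{-c}` in `biHurw`. -/
noncomputable def polar (c : ℕ) (w : List ℕ) (p q : ℕ) : ℝ := (biHurw w p q).coeff (-(c : ℤ))

lemma qsym_negForms (p : ℕ) (w : List ℕ) :
    qsym (negForms p) w = HahnSeries.ofPowerSeries ℤ ℝ (hurwNeg p w) := by
  rw [hurwNeg, map_qsym, negForms, List.map_reverse, List.map_map]
  congr 2
  refine List.map_congr_left fun i _ => ?_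
  rw [← coe_X_add_C_inv (neg_ne_zero.2 (by positivity))]
  simp [sub_eq_add_neg]

lemma qsym_posForms (q : ℕ) (w : List ℕ) :
    qsym (posForms q) w = HahnSeries.ofPowerSeries ℤ ℝ (hurw q w) := by
  rw [hurw, map_qsym, posForms, posSer, List.map_map]
  congr 1
  refine List.map_congr_left fun i _ => ?_
  rw [← coe_X_add_C_inv (by positivity)]
  rfl

lemma polar_eq (c : ℕ) (w : List ℕ) (p q : ℕ) :
    polar c w p q =
      (if c = 0 then ∑ i ∈ Finset.range (w.length + 1),
        PowerSeries.coeff 0 (hurwNeg p (w.take i)) * PowerSeries.coeff 0 (hurw q (w.drop i))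
        else 0) +
      ∑ j ∈ Finset.range w.length, if c ≤ w.getD j 0 then
        PowerSeries.coeff (w.getD j 0 - c) (hurwNeg p (w.take j) * hurw q (w.drop (j + 1)))
        else 0 := by
  rw [polar, biHurw, qsym_append_cons, HahnSeries.coeff_add]
  simp only [qsym_negForms, qsym_posForms]
  congr 1
  · simp only [← map_mul, ← map_sum]
    rw [PowerSeries.coeff_coe]
    by_cases hc : c = 0
    · simp [hc]
    · rw [if_pos (by omega), if_neg hc]
  · rw [HahnSeries.coeff_sum]
    refine Finset.sum_congr rfl fun j _ => ?_
    rw [linForm_zero_inv_pow, mul_left_comm, ← map_mul, HahnSeries.coeff_single_mul, one_mul,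
      PowerSeries.coeff_coe]
    by_cases h : c ≤ w.getD j 0
    · rw [if_pos h, if_neg (by omega)]
      congr 2
      omega
    · rw [if_neg h, if_pos (by omega)]

lemma getD_le_sum (w : List ℕ) (j : ℕ) : w.getD j 0 ≤ w.sum := by
  induction w generalizing j with
  | nil => simp
  | cons k w ih =>
    cases j with
    | zero => simp
    | succ j =>
      have := ih j
      simp only [List.getD_cons_succ, List.sum_cons]
      omega

lemma polar_eq_zero {c : ℕ} {w : List ℕ} (h : w.sum < c) (p q : ℕ) : polar c w p q = 0 := by
  rw [polar_eq, if_neg (by omega), zero_add]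
  refine Finset.sum_eq_zero fun j _ => if_neg ?_
  have := getD_le_sum w j
  omega

lemma biHurw_succ_left (k : ℕ) (w : List ℕ) (p q : ℕ) :
    biHurw (k :: w) (p + 1) q =
      biHurw (k :: w) p q + (linForm (-((p : ℝ) + 1)))⁻¹ ^ k * biHurw w p q := by
  have h : negForms (p + 1) = (linForm (-((p : ℝ) + 1)))⁻¹ :: negForms p := by
    rw [negForms, List.range_succ]
    simp [negForms]
  rw [biHurw, h, List.cons_append, qsym_cons_cons]
  rfl

lemma biHurw_succ_right (k : ℕ) (w : List ℕ) (p q : ℕ) :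
    biHurw (w ++ [k]) p (q + 1) =
      biHurw (w ++ [k]) p q + (linForm ((q : ℝ) + 1))⁻¹ ^ k * biHurw w p q := by
  have h : posForms (q + 1) = posForms q ++ [(linForm ((q : ℝ) + 1))⁻¹] := by
    rw [posForms, List.range_succ]
    simp [posForms]
  rw [biHurw, h, ← List.cons_append, ← List.append_assoc, qsym_append_singleton]
  rfl

lemma polar_succ_left {k : ℕ} (hk : 0 < k) (c : ℕ) (w : List ℕ) (p q : ℕ) :
    polar c (k :: w) (p + 1) q = polar c (k :: w) p q + ∑ a ∈ Finset.range (w.sum + 1),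
      ((-1) ^ a * (Nat.choose (k - 1 + a) a : ℝ) * (-((p : ℝ) + 1))⁻¹ ^ (k + a)) *
        polar (c + a) w p q := by
  have hp : -((p : ℝ) + 1) ≠ 0 := neg_ne_zero.2 (by positivity)
  rw [polar, biHurw_succ_left, HahnSeries.coeff_add, ← coe_X_add_C_inv hp, ← map_pow,
    coe_mul_coeff_neg _ _ w.sum fun n hn => polar_eq_zero hn p q]
  simp only [coeff_X_add_C_inv_pow hp hk]
  rfl

lemma polar_succ_right {k : ℕ} (hk : 0 < k) (c : ℕ) (w : List ℕ) (p q : ℕ) :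
    polar c (w ++ [k]) p (q + 1) = polar c (w ++ [k]) p q + ∑ a ∈ Finset.range (w.sum + 1),
      ((-1) ^ a * (Nat.choose (k - 1 + a) a : ℝ) * ((q : ℝ) + 1)⁻¹ ^ (k + a)) *
        polar (c + a) w p q := by
  have hq : (q : ℝ) + 1 ≠ 0 := by positivity
  rw [polar, biHurw_succ_right, HahnSeries.coeff_add, ← coe_X_add_C_inv hq, ← map_pow,
    coe_mul_coeff_neg _ _ w.sum fun n hn => polar_eq_zero hn p q]
  simp only [coeff_X_add_C_inv_pow hq hk]
  rfl

end Laurent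

section Residue

/-- The inverse of `T + m`, recentred at `-n`. -/
noncomputable def shiftedInv (m n : ℕ) : LaurentSeries ℝ := (linForm ((m : ℝ) - n))⁻¹

lemma map_shiftedInv_range (n q : ℕ) :
    (List.range (n + q + 1)).map (fun m => shiftedInv m n) =
      negForms n ++ (linForm 0)⁻¹ :: posForms q := by
  rw [add_assoc, List.range_add, List.map_append, List.map_map, add_comm q 1, List.range_add,
    List.map_append, List.map_map]
  congr 1
  · rw [negForms]
    refine List.ext_getElem (by simp) fun i hi hi' => ?_
    simp only [List.length_map, List.length_range] at hi
    simp only [List.getElem_map, List.getElem_range, List.getElem_reverse, List.length_map,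
      List.length_range, shiftedInv]
    congr 2
    rw [show n - 1 - i = n - (i + 1) by omega, Nat.cast_sub (by omega)]
    push_cast
    ring
  · simp only [List.range_one, List.map_cons, List.map_nil, List.singleton_append, posForms]
    congr 1
    · simp [shiftedInv]
    · refine List.map_congr_left fun i _ => ?_
      simp only [Function.comp_apply, shiftedInv]
      congr 2
      push_cast
      ring

lemma biHurw_eq_qsym_shiftedInv (w : List ℕ) {n S : ℕ} (h : n ≤ S) :
    biHurw w n (S - n) = qsym ((List.range (S + 1)).map shiftedInv) w n := by
  have h1 := map_qsym (Pi.evalRingHom (fun _ : ℕ => LaurentSeries ℝ) n)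
    ((List.range (S + 1)).map shiftedInv) w
  rw [Pi.evalRingHom_apply] at h1
  rw [h1, biHurw, ← map_shiftedInv_range, Nat.add_sub_cancel' h, List.map_map]
  rfl

/-- Multiplication by a constant, on families of Laurent series. -/
noncomputable def constFam (r : ℝ) : ℕ → LaurentSeries ℝ := fun _ => HahnSeries.C r

/-- Combinations of positive powers of the `shiftedInv m`, `m ≤ S`. -/
noncomputable def poleSpan (S : ℕ) : AddSubgroup (ℕ → LaurentSeries ℝ) :=
  AddSubgroup.closure {f | ∃ r : ℝ, ∃ m ≤ S, ∃ c : ℕ, 0 < c ∧ f = constFam r * shiftedInv m ^ c}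

/-- The elements of `poleSpan` of vanishing total residue. -/
noncomputable def poleSpanTwo (S : ℕ) : AddSubgroup (ℕ → LaurentSeries ℝ) :=
  AddSubgroup.closure
    ({f | ∃ r : ℝ, ∃ m ≤ S, ∃ c : ℕ, 2 ≤ c ∧ f = constFam r * shiftedInv m ^ c} ∪
      {f | ∃ r : ℝ, ∃ m ≤ S, ∃ m' ≤ S, f = constFam r * (shiftedInv m - shiftedInv m')})

lemma mem_poleSpan {S : ℕ} (r : ℝ) {m : ℕ} (hm : m ≤ S) {c : ℕ} (hc : 0 < c) :
    constFam r * shiftedInv m ^ c ∈ poleSpan S :=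
  AddSubgroup.subset_closure ⟨r, m, hm, c, hc, rfl⟩

lemma mem_poleSpanTwo {S : ℕ} (r : ℝ) {m : ℕ} (hm : m ≤ S) {c : ℕ} (hc : 2 ≤ c) :
    constFam r * shiftedInv m ^ c ∈ poleSpanTwo S :=
  AddSubgroup.subset_closure (Or.inl ⟨r, m, hm, c, hc, rfl⟩)

lemma constFam_one : constFam 1 = 1 := by
  funext n
  exact HahnSeries.C_one

lemma poleSpanTwo_le (S : ℕ) : poleSpanTwo S ≤ poleSpan S := by
  refine (AddSubgroup.closure_le _).2 ?_
  rintro f (⟨r, m, hm, c, hc, rfl⟩ | ⟨r, m, hm, m', hm', rfl⟩)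
  · exact mem_poleSpan r hm (by omega)
  · have h := sub_mem (mem_poleSpan r hm one_pos) (mem_poleSpan r hm' one_pos)
    rwa [pow_one, pow_one, ← mul_sub] at h

lemma constFam_mul_shiftedInv {m m' : ℕ} (h : m ≠ m') (r : ℝ) :
    constFam r * (shiftedInv m * shiftedInv m') =
      constFam (r / ((m' : ℝ) - m)) * (shiftedInv m - shiftedInv m') := by
  have h0 : ((m' : ℝ) - m) ≠ 0 := sub_ne_zero.2 (by exact_mod_cast h.symm)
  funext n
  have h1 := linForm_inv_mul ((m : ℝ) - n) ((m' : ℝ) - n)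
  rw [sub_sub_sub_cancel_right] at h1
  simp only [Pi.mul_apply, Pi.sub_apply, constFam, shiftedInv]
  rw [← h1, ← mul_assoc (HahnSeries.C (r / ((m' : ℝ) - m))), ← map_mul, div_mul_cancel₀ _ h0]

lemma mul_pow_mem_poleSpanTwo {S m m' : ℕ} (hm : m ≤ S) (hm' : m' ≤ S) (c c' : ℕ) :
    ∀ r : ℝ, 2 ≤ c + c' → constFam r * (shiftedInv m ^ c * shiftedInv m' ^ c') ∈ poleSpanTwo S := by
  by_cases hmm : m = m'
  · subst hmm
    intro r h
    rw [← pow_add]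
    exact mem_poleSpanTwo r hm h
  induction c generalizing c' with
  | zero =>
    intro r h
    rw [pow_zero, one_mul]
    exact mem_poleSpanTwo r hm' (by omega)
  | succ c ih =>
    induction c' with
    | zero =>
      intro r h
      rw [pow_zero, mul_one]
      exact mem_poleSpanTwo r hm (by omega)
    | succ c' ih' =>
      intro r h
      have h1 : constFam r * (shiftedInv m ^ (c + 1) * shiftedInv m' ^ (c' + 1)) =
          constFam (r / ((m' : ℝ) - m)) * (shiftedInv m ^ (c + 1) * shiftedInv m' ^ c') -
          constFam (r / ((m' : ℝ) - m)) * (shiftedInv m ^ c * shiftedInv m' ^ (c' + 1)) := by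
        linear_combination (shiftedInv m ^ c * shiftedInv m' ^ c') * constFam_mul_shiftedInv hmm r
      by_cases h2 : c + c' = 0
      · obtain ⟨rfl, rfl⟩ : c = 0 ∧ c' = 0 := by omega
        rw [h1, ← mul_sub]
        simp only [zero_add, pow_one, pow_zero, one_mul, mul_one]
        exact AddSubgroup.subset_closure (Or.inr ⟨_, m, hm, m', hm', rfl⟩)
      · rw [h1]
        exact sub_mem (ih' _ (by omega)) (ih _ _ (by omega))

lemma constFam_mul (r s : ℝ) : constFam r * constFam s = constFam (r * s) := by
  funext n
  simp [constFam]

lemma mul_mem_poleSpanTwo {S : ℕ} {f g : ℕ → LaurentSeries ℝ} (hf : f ∈ poleSpan S)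
    (hg : g ∈ poleSpan S) : f * g ∈ poleSpanTwo S := by
  refine AddSubgroup.closure_induction₂ (p := fun f g _ _ => f * g ∈ poleSpanTwo S)
    ?_ ?_ ?_ ?_ ?_ ?_ ?_ hf hg
  · rintro _ _ ⟨r, m, hm, c, hc, rfl⟩ ⟨r', m', hm', c', hc', rfl⟩
    rw [mul_mul_mul_comm, constFam_mul]
    exact mul_pow_mem_poleSpanTwo hm hm' c c' _ (by omega)
  · intro x _
    rw [zero_mul]
    exact zero_mem _
  · intro x _
    rw [mul_zero]
    exact zero_mem _
  · intro x y z _ _ _ h h'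
    rw [add_mul]
    exact add_mem h h'
  · intro x y z _ _ _ h h'
    rw [mul_add]
    exact add_mem h h'
  · intro x y _ _ h
    have h1 : -x * y = -(x * y) := neg_mul x y
    rw [h1]
    exact neg_mem h
  · intro x y _ _ h
    have h1 : x * -y = -(x * y) := mul_neg x y
    rw [h1]
    exact neg_mem h

lemma qsym_mem_poleSpan {S : ℕ} (ms : List ℕ) (hms : ∀ m ∈ ms, m ≤ S) (w : List ℕ)
    (hw : ∀ k ∈ w, 0 < k) (hne : w ≠ []) :
    qsym (ms.map shiftedInv) w ∈ poleSpan S ∧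
      (2 ≤ w.sum → qsym (ms.map shiftedInv) w ∈ poleSpanTwo S) := by
  induction ms generalizing w with
  | nil =>
    cases w with
    | nil => exact absurd rfl hne
    | cons k w =>
      rw [List.map_nil, qsym_nil_cons]
      exact ⟨zero_mem _, fun _ => zero_mem _⟩
  | cons m ms ih =>
    have hms' : ∀ m ∈ ms, m ≤ S := fun z hz => hms z (by simp [hz])
    have hm : m ≤ S := hms m (by simp)
    cases w with
    | nil => exact absurd rfl hne
    | cons k w =>
      have hk : 0 < k := hw k (by simp)
      have hx : ∀ c : ℕ, shiftedInv m ^ c = constFam 1 * shiftedInv m ^ c := fun c => by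
        rw [constFam_one, one_mul]
      rw [List.map_cons, qsym_cons_cons]
      obtain ⟨h1, h2⟩ := ih hms' (k :: w) hw hne
      by_cases hw0 : w = []
      · subst hw0
        rw [qsym_nil_right, mul_one, hx]
        refine ⟨add_mem h1 (mem_poleSpan _ hm hk), fun h => add_mem (h2 h)
          (mem_poleSpanTwo _ hm ?_)⟩
        simpa using h
      · have h3 : shiftedInv m ^ k * qsym (ms.map shiftedInv) w ∈ poleSpanTwo S := by
          refine mul_mem_poleSpanTwo ?_ (ih hms' w (fun z hz => hw z (by simp [hz])) hw0).1
          rw [hx]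
          exact mem_poleSpan _ hm hk
        exact ⟨add_mem h1 (poleSpanTwo_le S h3), fun h => add_mem (h2 h) h3⟩

lemma shiftedInv_self_pow (n c : ℕ) :
    shiftedInv n n ^ c = HahnSeries.single (-(c : ℤ)) (1 : ℝ) := by
  rw [shiftedInv, sub_self, linForm_zero_inv_pow]

lemma coeff_shiftedInv_pow_neg {m n : ℕ} {c c' : ℕ} (hc : 0 < c) :
    (shiftedInv m n ^ c').coeff (-(c : ℤ)) = if n = m ∧ c = c' then 1 else 0 := by
  by_cases h : n = m
  · subst h
    rw [shiftedInv_self_pow, HahnSeries.coeff_single]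
    simp
  · rw [if_neg (by tauto)]
    exact coeff_linForm_inv_pow_neg
      (sub_ne_zero.2 fun h' => h (by exact_mod_cast h'.symm)) _ hc

lemma sum_residue_eq_zero {S : ℕ} {f : ℕ → LaurentSeries ℝ} (hf : f ∈ poleSpanTwo S) :
    ∑ n ∈ Finset.range (S + 1), (f n).coeff (-1) = 0 := by
  have key : ∀ m ≤ S, ∀ c, ∑ n ∈ Finset.range (S + 1), (shiftedInv m n ^ c).coeff (-1) =
      if 1 = c then 1 else 0 := by
    intro m hm c
    have h : ∀ n, (shiftedInv m n ^ c).coeff (-1) =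
        if n = m then (if 1 = c then 1 else 0) else 0 := by
      intro n
      have := coeff_shiftedInv_pow_neg (m := m) (n := n) (c' := c) one_pos
      rw [Nat.cast_one] at this
      rw [this, ite_and]
    simp only [h]
    rw [Finset.sum_ite_eq' _ m, if_pos (Finset.mem_range.2 (by omega))]
  refine AddSubgroup.closure_induction
    (p := fun f _ => ∑ n ∈ Finset.range (S + 1), (f n).coeff (-1) = 0) ?_ ?_ ?_ ?_ hf
  · rintro f (⟨r, m, hm, c, hc, rfl⟩ | ⟨r, m, hm, m', hm', rfl⟩)
    · simp only [Pi.mul_apply, Pi.pow_apply, constFam, HahnSeries.C_mul_eq_smul,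
        HahnSeries.coeff_smul, smul_eq_mul, ← Finset.mul_sum, key m hm c]
      rw [if_neg (by omega), mul_zero]
    · have h1 := key m hm 1
      have h2 := key m' hm' 1
      simp only [pow_one] at h1 h2
      simp only [Pi.mul_apply, Pi.sub_apply, constFam, HahnSeries.C_mul_eq_smul,
        HahnSeries.coeff_smul, smul_eq_mul, ← Finset.mul_sum, HahnSeries.coeff_sub,
        Finset.sum_sub_distrib, h1, h2]
      simp
  · simp
  · intro x y _ _ hx hy
    simp only [Pi.add_apply, HahnSeries.coeff_add, Finset.sum_add_distrib, hx, hy, add_zero]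
  · intro x _ hx
    simp only [Pi.neg_apply, HahnSeries.coeff_neg, Finset.sum_neg_distrib, hx, neg_zero]

lemma exists_expand {S n₀ : ℕ} {f : ℕ → LaurentSeries ℝ} (hf : f ∈ poleSpan S) :
    ∃ K₀ : ℕ, ∀ K ≥ K₀, (f n₀).coeff 0 = ∑ n ∈ (Finset.range (S + 1)).erase n₀,
      ∑ c ∈ Finset.Icc 1 K, ((n : ℝ) - n₀)⁻¹ ^ c * (f n).coeff (-(c : ℤ)) := by
  refine AddSubgroup.closure_induction
    (p := fun f _ => ∃ K₀ : ℕ, ∀ K ≥ K₀, (f n₀).coeff 0 = ∑ n ∈ (Finset.range (S + 1)).erase n₀,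
      ∑ c ∈ Finset.Icc 1 K, ((n : ℝ) - n₀)⁻¹ ^ c * (f n).coeff (-(c : ℤ))) ?_ ?_ ?_ ?_ hf
  · rintro f ⟨r, m, hm, c, hc, rfl⟩
    refine ⟨c, fun K hK => ?_⟩
    have h : ∀ n : ℕ, ∑ c' ∈ Finset.Icc 1 K, ((n : ℝ) - n₀)⁻¹ ^ c' *
        ((constFam r * shiftedInv m ^ c) n).coeff (-(c' : ℤ)) =
        if n = m then r * ((m : ℝ) - n₀)⁻¹ ^ c else 0 := by
      intro n
      by_cases hn : n = m
      · subst hn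
        rw [if_pos rfl, Finset.sum_eq_single c]
        · simp only [Pi.mul_apply, Pi.pow_apply, constFam, HahnSeries.C_mul_eq_smul,
            HahnSeries.coeff_smul, smul_eq_mul, coeff_shiftedInv_pow_neg hc]
          simp [mul_comm]
        · intro c' hc' hne
          simp only [Pi.mul_apply, Pi.pow_apply, constFam, HahnSeries.C_mul_eq_smul,
            HahnSeries.coeff_smul, smul_eq_mul, coeff_shiftedInv_pow_neg (Finset.mem_Icc.1 hc').1]
          simp [hne]
        · intro hc'
          exact absurd (Finset.mem_Icc.2 ⟨hc, hK⟩) hc'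
      · rw [if_neg hn]
        refine Finset.sum_eq_zero fun c' hc' => ?_
        simp only [Pi.mul_apply, Pi.pow_apply, constFam, HahnSeries.C_mul_eq_smul,
            HahnSeries.coeff_smul, smul_eq_mul, coeff_shiftedInv_pow_neg (Finset.mem_Icc.1 hc').1]
        simp [hn]
    simp only [h]
    rw [Finset.sum_ite_eq' _ m]
    simp only [Pi.mul_apply, Pi.pow_apply, constFam, HahnSeries.C_mul_eq_smul,
            HahnSeries.coeff_smul, smul_eq_mul]
    by_cases hmn : m = n₀
    · subst hmn
      rw [if_neg (by simp), shiftedInv_self_pow, HahnSeries.coeff_single, if_neg (by omega),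
        mul_zero]
    · rw [if_pos (Finset.mem_erase.2 ⟨hmn, Finset.mem_range.2 (by omega)⟩), shiftedInv,
        coeff_linForm_inv_pow_zero (sub_ne_zero.2 fun h' => hmn (by exact_mod_cast h')) hc]
  · exact ⟨0, fun K _ => by simp⟩
  · rintro x y _ _ ⟨K₁, h₁⟩ ⟨K₂, h₂⟩
    refine ⟨max K₁ K₂, fun K hK => ?_⟩
    simp only [Pi.add_apply, HahnSeries.coeff_add, mul_add, Finset.sum_add_distrib]
    rw [h₁ K (le_trans (le_max_left _ _) hK), h₂ K (le_trans (le_max_right _ _) hK)]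
  · rintro x _ ⟨K₁, h₁⟩
    refine ⟨K₁, fun K hK => ?_⟩
    simp only [Pi.neg_apply, HahnSeries.coeff_neg, mul_neg, Finset.sum_neg_distrib]
    rw [h₁ K hK]

lemma sum_polar_one_eq_zero {w : List ℕ} (hw : ∀ k ∈ w, 0 < k) (hne : w ≠ []) (h2 : 2 ≤ w.sum)
    (S : ℕ) : ∑ n ∈ Finset.range (S + 1), polar 1 w n (S - n) = 0 := by
  have h := sum_residue_eq_zero ((qsym_mem_poleSpan (S := S) (List.range (S + 1))
    (fun m hm => by have := List.mem_range.1 hm; omega) w hw hne).2 h2)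
  rw [← h]
  refine Finset.sum_congr rfl fun n hn => ?_
  rw [polar, biHurw_eq_qsym_shiftedInv w (by have := Finset.mem_range.1 hn; omega)]
  simp

lemma polar_zero_expand {w : List ℕ} (hw : ∀ k ∈ w, 0 < k) (hne : w ≠ []) (N : ℕ) :
    polar 0 w N N = ∑ n ∈ (Finset.range (2 * N + 1)).erase N,
      ∑ c ∈ Finset.Icc 1 w.sum, ((n : ℝ) - N)⁻¹ ^ c * polar c w n (2 * N - n) := by
  obtain ⟨K₀, hK⟩ := exists_expand (n₀ := N) (qsym_mem_poleSpan (S := 2 * N)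
    (List.range (2 * N + 1)) (fun m hm => by have := List.mem_range.1 hm; omega) w hw hne).1
  have h := hK (max K₀ w.sum) (le_max_left _ _)
  rw [← biHurw_eq_qsym_shiftedInv w (by omega), show 2 * N - N = N by omega] at h
  rw [polar, Nat.cast_zero, neg_zero, h]
  refine Finset.sum_congr rfl fun n hn => ?_
  have hn' : n ≤ 2 * N := by
    have := Finset.mem_range.1 (Finset.mem_of_mem_erase hn)
    omega
  symm
  rw [← biHurw_eq_qsym_shiftedInv w hn']
  refine Finset.sum_subset (Finset.Icc_subset_Icc le_rfl (le_max_right _ _)) fun c _ hc => ?_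
  have h0 : polar c w n (2 * N - n) = 0 := by
    refine polar_eq_zero ?_ _ _
    simp only [Finset.mem_Icc] at *
    omega
  exact mul_eq_zero_of_right _ h0

end Residue

section LogBdd

/-- `g` is bounded by `h` up to a power of the logarithm. -/
def LogBdd (g h : ℕ → ℕ → ℝ) : Prop :=
  ∃ C : ℝ, 0 ≤ C ∧ ∃ r : ℕ, ∀ p q, |g p q| ≤ C * (1 + harm (p + q)) ^ r * h p q

lemma one_le_one_add_harm (M : ℕ) : 1 ≤ 1 + harm M := le_add_of_nonneg_right (harm_nonneg M)

lemma LogBdd.mono {g h h' : ℕ → ℕ → ℝ} (hg : LogBdd g h) (hh : ∀ p q, h p q ≤ h' p q) :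
    LogBdd g h' := by
  obtain ⟨C, hC, r, H⟩ := hg
  refine ⟨C, hC, r, fun p q => (H p q).trans ?_⟩
  have := one_le_one_add_harm (p + q)
  have := hh p q
  gcongr

lemma LogBdd.add {g g' h : ℕ → ℕ → ℝ} (hh : ∀ p q, 0 ≤ h p q) (hg : LogBdd g h)
    (hg' : LogBdd g' h) : LogBdd (fun p q => g p q + g' p q) h := by
  obtain ⟨C, hC, r, H⟩ := hg
  obtain ⟨C', hC', r', H'⟩ := hg'
  refine ⟨C + C', by positivity, r + r', fun p q => (abs_add_le _ _).trans ?_⟩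
  have h1 := one_le_one_add_harm (p + q)
  have h2 : (1 + harm (p + q)) ^ r ≤ (1 + harm (p + q)) ^ (r + r') :=
    pow_le_pow_right₀ h1 (by omega)
  have h3 : (1 + harm (p + q)) ^ r' ≤ (1 + harm (p + q)) ^ (r + r') :=
    pow_le_pow_right₀ h1 (by omega)
  have h4 := hh p q
  calc _ ≤ C * (1 + harm (p + q)) ^ r * h p q + C' * (1 + harm (p + q)) ^ r' * h p q :=
        add_le_add (H p q) (H' p q)
    _ ≤ C * (1 + harm (p + q)) ^ (r + r') * h p q +
        C' * (1 + harm (p + q)) ^ (r + r') * h p q := by gcongr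
    _ = _ := by ring

lemma LogBdd.zero {h : ℕ → ℕ → ℝ} : LogBdd (fun _ _ => 0) h :=
  ⟨0, le_rfl, 0, fun p q => by simp⟩

lemma LogBdd.sum {ι : Type*} {g : ι → ℕ → ℕ → ℝ} {h : ℕ → ℕ → ℝ} (hh : ∀ p q, 0 ≤ h p q)
    (s : Finset ι) (hg : ∀ i ∈ s, LogBdd (g i) h) :
    LogBdd (fun p q => ∑ i ∈ s, g i p q) h := by
  classical
  induction s using Finset.induction_on with
  | empty => simpa using LogBdd.zero
  | insert i s hi ih =>
    simp only [Finset.sum_insert hi]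
    exact LogBdd.add hh (hg i (by simp)) (ih fun j hj => hg j (by simp [hj]))

lemma LogBdd.mul {g g' h h' : ℕ → ℕ → ℝ} (hg : LogBdd g h) (hg' : LogBdd g' h') :
    LogBdd (fun p q => g p q * g' p q) (fun p q => h p q * h' p q) := by
  obtain ⟨C, hC, r, H⟩ := hg
  obtain ⟨C', hC', r', H'⟩ := hg'
  refine ⟨C * C', by positivity, r + r', fun p q => ?_⟩
  rw [abs_mul]
  refine (mul_le_mul (H p q) (H' p q) (abs_nonneg _) ((abs_nonneg _).trans (H p q))).trans_eq ?_
  ring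

lemma LogBdd.of_le {g h : ℕ → ℕ → ℝ} (C : ℝ) (hC : 0 ≤ C) (H : ∀ p q, |g p q| ≤ C * h p q) :
    LogBdd g h := ⟨C, hC, 0, fun p q => by simpa using H p q⟩

lemma LogBdd.neg {g h : ℕ → ℕ → ℝ} (hg : LogBdd g h) : LogBdd (fun p q => -g p q) h := by
  obtain ⟨C, hC, r, H⟩ := hg
  exact ⟨C, hC, r, fun p q => by simpa using H p q⟩

lemma exists_zetaA_recips_le (a : ℕ) {l : List ℕ} (hl : ∀ k ∈ l, 0 < k) :
    ∃ C : ℝ, 0 ≤ C ∧ ∀ M, |zetaA (qsym (recips M)) a l| ≤ C * (1 + harm M) ^ l.length := by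
  refine ⟨∑ f ∈ (Fintype.piFinset fun _ : Fin l.length => Finset.range (a + 1)).filter
        (fun f => ∑ i, f i = a), ∏ i, (Nat.choose (l.get i - 1 + f i) (f i) : ℝ),
    Finset.sum_nonneg fun _ _ => Finset.prod_nonneg fun _ _ => by positivity, fun M => ?_⟩
  rw [zetaA, abs_mul, abs_pow, abs_neg, abs_one, one_pow, one_mul, Finset.sum_mul]
  refine (Finset.abs_sum_le_sum_abs _ _).trans (Finset.sum_le_sum fun f _ => ?_)
  have h0 : (0 : ℝ) ≤ ∏ i, (Nat.choose (l.get i - 1 + f i) (f i) : ℝ) :=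
    Finset.prod_nonneg fun _ _ => by positivity
  rw [abs_mul, abs_of_nonneg h0, abs_of_nonneg (qsym_recips_nonneg _ _), mul_comm]
  refine mul_le_mul_of_nonneg_left ?_ h0
  refine (qsym_recips_le M ?_).trans ?_
  · intro k hk
    obtain ⟨i, rfl⟩ := (List.mem_ofFn' _ _).1 hk
    exact Nat.add_pos_left (hl _ (List.get_mem l i)) _
  · rw [List.length_ofFn]
    exact pow_le_pow_left₀ (harm_nonneg M) (by linarith) _

lemma logBdd_coeff_hurw (a : ℕ) {w : List ℕ} (hw : ∀ k ∈ w, 0 < k) :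
    LogBdd (fun _ q => PowerSeries.coeff a (hurw q w)) fun _ _ => 1 := by
  obtain ⟨C, hC, H⟩ := exists_zetaA_recips_le a hw
  refine ⟨C, hC, w.length, fun p q => ?_⟩
  simp only [coeff_hurw q hw, mul_one]
  refine (H q).trans ?_
  have := harm_nonneg q
  have : harm q ≤ harm (p + q) := harm_mono (by omega)
  gcongr

lemma logBdd_coeff_hurwNeg (a : ℕ) {w : List ℕ} (hw : ∀ k ∈ w, 0 < k) :
    LogBdd (fun p _ => PowerSeries.coeff a (hurwNeg p w)) fun _ _ => 1 := by
  obtain ⟨C, hC, H⟩ := exists_zetaA_recips_le a (l := w.reverse)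
    fun k hk => hw k (List.mem_reverse.1 hk)
  refine ⟨C, hC, w.reverse.length, fun p q => ?_⟩
  simp only [coeff_hurwNeg p hw, mul_one]
  rw [abs_mul, abs_pow, abs_neg, abs_one, one_pow, one_mul]
  refine (H p).trans ?_
  have := harm_nonneg p
  have : harm p ≤ harm (p + q) := harm_mono (by omega)
  gcongr

lemma logBdd_polar (c : ℕ) {w : List ℕ} (hw : ∀ k ∈ w, 0 < k) :
    LogBdd (polar c w) fun _ _ => 1 := by
  have hnn : ∀ p q : ℕ, (0 : ℝ) ≤ (fun _ _ : ℕ => (1 : ℝ)) p q := fun _ _ => zero_le_one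
  have htake : ∀ i, ∀ k ∈ w.take i, 0 < k := fun i k hk => hw k (List.mem_of_mem_take hk)
  have hdrop : ∀ i, ∀ k ∈ w.drop i, 0 < k := fun i k hk => hw k (List.mem_of_mem_drop hk)
  have hmul : ∀ a b i j, LogBdd (fun p q => PowerSeries.coeff a (hurwNeg p (w.take i)) *
      PowerSeries.coeff b (hurw q (w.drop j))) fun _ _ => 1 := fun a b i j => by
    simpa using (logBdd_coeff_hurwNeg a (htake i)).mul (logBdd_coeff_hurw b (hdrop j))
  have h : polar c w = fun p q => _ := funext fun p => funext fun q => polar_eq c w p q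
  rw [h]
  refine LogBdd.add hnn ?_ (LogBdd.sum hnn _ fun j _ => ?_)
  · split_ifs
    · exact LogBdd.sum hnn _ fun i _ => hmul _ _ _ _
    · exact LogBdd.zero
  · split_ifs
    · simp only [PowerSeries.coeff_mul]
      exact LogBdd.sum hnn _ fun x _ => hmul _ _ _ _
    · exact LogBdd.zero

lemma abs_coeff_le {y z : ℝ} (hy : |y| = z) (k a : ℕ) :
    |(-1) ^ a * (Nat.choose (k - 1 + a) a : ℝ) * y ^ (k + a)| =
      (Nat.choose (k - 1 + a) a : ℝ) * z ^ (k + a) := by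
  rw [abs_mul, abs_mul, abs_pow, abs_pow, abs_neg, abs_one, one_pow, one_mul, hy, Nat.abs_cast]

lemma abs_neg_succ_inv (p : ℕ) : |(-((p : ℝ) + 1))⁻¹| = ((p : ℝ) + 1)⁻¹ := by
  rw [abs_inv, abs_neg, abs_of_nonneg (by positivity)]

lemma abs_succ_inv (p : ℕ) : |((p : ℝ) + 1)⁻¹| = ((p : ℝ) + 1)⁻¹ :=
  abs_of_nonneg (by positivity)

lemma succ_inv_pow_le (p : ℕ) {m n : ℕ} (h : m ≤ n) :
    ((p : ℝ) + 1)⁻¹ ^ n ≤ ((p : ℝ) + 1)⁻¹ ^ m :=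
  pow_le_pow_of_le_one (by positivity) (inv_le_one_of_one_le₀ (by simp)) h

lemma logBdd_polar_succ_left (c : ℕ) {w : List ℕ} (hw : ∀ k ∈ w, 0 < k) (hne : w ≠ []) :
    LogBdd (fun p q => polar c w (p + 1) q - polar c w p q) fun p _ => ((p : ℝ) + 1)⁻¹ := by
  cases w with
  | nil => exact absurd rfl hne
  | cons k w =>
    have hk : 0 < k := hw k (by simp)
    simp only [polar_succ_left hk, add_sub_cancel_left]
    refine LogBdd.sum (fun p q => by positivity) _ fun a _ => ?_
    have h1 : LogBdd (fun p _ => (-1) ^ a * (Nat.choose (k - 1 + a) a : ℝ) *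
        (-((p : ℝ) + 1))⁻¹ ^ (k + a)) fun p _ => ((p : ℝ) + 1)⁻¹ := by
      refine LogBdd.of_le (Nat.choose (k - 1 + a) a : ℝ) (by positivity) fun p q => ?_
      rw [abs_coeff_le (abs_neg_succ_inv p)]
      have := succ_inv_pow_le p (show 1 ≤ k + a by omega)
      rw [pow_one] at this
      gcongr
    simpa using h1.mul (logBdd_polar (c + a) fun z hz => hw z (by simp [hz]))

lemma logBdd_polar_succ_right (c : ℕ) {w : List ℕ} {k : ℕ} (hw : ∀ k ∈ w, 0 < k) (hk : 0 < k)
    {m : ℕ} (hm : m ≤ k) :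
    LogBdd (fun p q => polar c (w ++ [k]) p (q + 1) - polar c (w ++ [k]) p q)
      fun _ q => ((q : ℝ) + 1)⁻¹ ^ m := by
  simp only [polar_succ_right hk, add_sub_cancel_left]
  refine LogBdd.sum (fun p q => by positivity) _ fun a _ => ?_
  have h1 : LogBdd (fun _ q => (-1) ^ a * (Nat.choose (k - 1 + a) a : ℝ) *
      ((q : ℝ) + 1)⁻¹ ^ (k + a)) fun _ q => ((q : ℝ) + 1)⁻¹ ^ m := by
    refine LogBdd.of_le (Nat.choose (k - 1 + a) a : ℝ) (by positivity) fun p q => ?_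
    rw [abs_coeff_le (abs_succ_inv q)]
    have := succ_inv_pow_le q (show m ≤ k + a by omega)
    gcongr
  simpa using h1.mul (logBdd_polar (c + a) hw)

lemma polar_one_singleton {k : ℕ} (hk : 2 ≤ k) (p q : ℕ) : polar 1 [k] p q = 0 := by
  rw [polar_eq]
  simp only [one_ne_zero, if_false, List.length_singleton, Finset.sum_range_one,
    List.getD_cons_zero, List.take_zero, hurwNeg, qsym_nil_right, one_mul, hurw, zero_add,
    List.drop_succ_cons, List.drop_nil, PowerSeries.coeff_one]
  rw [if_pos (by omega), if_neg (by omega)]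

lemma abs_sub_le_of_step {d μ : ℕ → ℝ} {B : ℝ} {S : ℕ}
    (h : ∀ i < S, |d (i + 1) - d i| ≤ B * (μ (i + 1) - μ i)) {i j : ℕ} (hij : i ≤ j)
    (hj : j ≤ S) : |d j - d i| ≤ B * (μ j - μ i) := by
  induction j, hij using Nat.le_induction with
  | base => simp
  | succ j hij ih =>
    have h1 := ih (by omega)
    have h2 := h j (by omega)
    calc |d (j + 1) - d i| = |(d (j + 1) - d j) + (d j - d i)| := by ring_nf
      _ ≤ _ := (abs_add_le _ _).trans (add_le_add h2 h1)
      _ = _ := by ring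

lemma sum_range_reflect_inv (S : ℕ) :
    ∑ j ∈ Finset.range S, (((S - 1 - j : ℕ) : ℝ) + 1)⁻¹ = harm S :=
  Finset.sum_range_reflect (fun j : ℕ => ((j : ℝ) + 1)⁻¹) S

/-- A sequence of zero mean with small second-order steps is small away from the ends. -/
lemma abs_le_of_step_of_sum_eq_zero {d : ℕ → ℝ} {B : ℝ} (hB : 0 ≤ B) {S : ℕ}
    (hd : ∀ p q, p + q + 1 = S → |d (p + 1) - d p| ≤
      B * (((p : ℝ) + 1)⁻¹ ^ 2 + ((q : ℝ) + 1)⁻¹ ^ 2))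
    (hsum : ∑ i ∈ Finset.range (S + 1), d i = 0) {p q : ℕ} (hpq : p + q = S) :
    |d p| ≤ 2 * B * (1 + harm (S + 1)) * (((p : ℝ) + 1)⁻¹ + ((q : ℝ) + 1)⁻¹) := by
  set μ : ℕ → ℝ := fun i => (((S - i : ℕ) : ℝ) + 1)⁻¹ - ((i : ℝ) + 1)⁻¹ with hμ
  have hstep : ∀ i < S, |d (i + 1) - d i| ≤ (2 * B) * (μ (i + 1) - μ i) := by
    intro i hi
    obtain ⟨q, rfl⟩ : ∃ q, S = i + q + 1 := ⟨S - i - 1, by omega⟩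
    refine (hd i q rfl).trans ?_
    simp only [hμ]
    rw [show i + q + 1 - i = q + 1 by omega, show i + q + 1 - (i + 1) = q by omega]
    push_cast
    have key : ∀ x : ℕ, ((x : ℝ) + 1)⁻¹ ^ 2 ≤ 2 * (((x : ℝ) + 1)⁻¹ - ((x : ℝ) + 1 + 1)⁻¹) := by
      intro x
      have hx : (0 : ℝ) ≤ x := by positivity
      rw [inv_sub_inv (by positivity) (by positivity), inv_pow, ← one_div, ← mul_div_assoc,
        div_le_div_iff₀ (by positivity) (by positivity)]
      nlinarith
    have h1 := key i
    have h2 := key q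
    nlinarith
  have hμle : ∀ i j, |μ i - μ j| ≤ (((i : ℝ) + 1)⁻¹ + (((S - i : ℕ) : ℝ) + 1)⁻¹) +
      (((j : ℝ) + 1)⁻¹ + (((S - j : ℕ) : ℝ) + 1)⁻¹) := by
    intro i j
    have h1 : 0 ≤ ((i : ℝ) + 1)⁻¹ := by positivity
    have h2 : 0 ≤ (((S - i : ℕ) : ℝ) + 1)⁻¹ := by positivity
    have h3 : 0 ≤ ((j : ℝ) + 1)⁻¹ := by positivity
    have h4 : 0 ≤ (((S - j : ℕ) : ℝ) + 1)⁻¹ := by positivity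
    rw [abs_le]
    simp only [hμ]
    constructor <;> linarith
  have hdiff : ∀ i ≤ S, ∀ j ≤ S, |d i - d j| ≤ (2 * B) * |μ i - μ j| := by
    intro i hi j hj
    rcases le_total i j with h | h
    · rw [abs_sub_comm]
      refine (abs_sub_le_of_step hstep h hj).trans ?_
      gcongr
      rw [abs_sub_comm]
      exact le_abs_self _
    · refine (abs_sub_le_of_step hstep h hi).trans ?_
      gcongr
      exact le_abs_self _
  have hq : q = S - p := by omega
  subst hq
  set ν : ℝ := ((p : ℝ) + 1)⁻¹ + (((S - p : ℕ) : ℝ) + 1)⁻¹ with hν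
  have hSd : ((S : ℝ) + 1) * d p = ∑ j ∈ Finset.range (S + 1), (d p - d j) := by
    rw [Finset.sum_sub_distrib, hsum, Finset.sum_const, Finset.card_range, nsmul_eq_mul]
    push_cast
    ring
  have hrefl : ∑ j ∈ Finset.range (S + 1), (((S - j : ℕ) : ℝ) + 1)⁻¹ = harm (S + 1) :=
    sum_range_reflect_inv (S + 1)
  have h1 : ((S : ℝ) + 1) * |d p| ≤ 2 * B * (((S : ℝ) + 1) * ν + 2 * harm (S + 1)) := by
    have h0 : |((S : ℝ) + 1)| = (S : ℝ) + 1 := abs_of_nonneg (by positivity)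
    rw [← h0, ← abs_mul, hSd, h0]
    refine (Finset.abs_sum_le_sum_abs _ _).trans ?_
    calc _ ≤ ∑ j ∈ Finset.range (S + 1), (2 * B) * (ν + (((j : ℝ) + 1)⁻¹ +
          (((S - j : ℕ) : ℝ) + 1)⁻¹)) := by
          refine Finset.sum_le_sum fun j hj => ?_
          refine (hdiff p (by omega) j (by have := Finset.mem_range.1 hj; omega)).trans ?_
          exact mul_le_mul_of_nonneg_left (hμle p j) (by positivity)
      _ = _ := by
          have hharm : ∑ j ∈ Finset.range (S + 1), ((j : ℝ) + 1)⁻¹ = harm (S + 1) := rfl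
          rw [← Finset.mul_sum, Finset.sum_add_distrib, Finset.sum_const, Finset.card_range,
            nsmul_eq_mul, Finset.sum_add_distrib, hrefl, hharm]
          push_cast
          ring
  have h2 : 2 ≤ ((S : ℝ) + 1) * ν := by
    have hS : (S : ℝ) = p + ((S - p : ℕ) : ℝ) := by
      rw [← Nat.cast_add]
      congr 1
      omega
    have hp : (0 : ℝ) ≤ p := by positivity
    have hq : (0 : ℝ) ≤ ((S - p : ℕ) : ℝ) := by positivity
    rw [hν, inv_add_inv (by positivity) (by positivity), ← mul_div_assoc,
      le_div_iff₀ (by positivity), hS]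
    nlinarith [sq_nonneg ((p : ℝ) - ((S - p : ℕ) : ℝ)), mul_nonneg hp hq]
  have hh := harm_nonneg (S + 1)
  have h3 : ((S : ℝ) + 1) * |d p| ≤ ((S : ℝ) + 1) * (2 * B * (1 + harm (S + 1)) * ν) := by
    refine h1.trans ?_
    have : 2 * harm (S + 1) ≤ ((S : ℝ) + 1) * ν * harm (S + 1) := by gcongr
    calc _ ≤ 2 * B * (((S : ℝ) + 1) * ν + ((S : ℝ) + 1) * ν * harm (S + 1)) := by gcongr
      _ = _ := by ring
  exact le_of_mul_le_mul_left h3 (by positivity)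

end LogBdd

section Steps

lemma LogBdd.sub_antidiagonal {g h : ℕ → ℕ → ℝ} (hh : ∀ p q, 0 ≤ h p q)
    (h1 : LogBdd (fun p q => g (p + 1) q - g p q) h)
    (h2 : LogBdd (fun p q => g p (q + 1) - g p q) h) :
    LogBdd (fun p q => g (p + 1) q - g p (q + 1)) h := by
  have := LogBdd.add hh h1 h2.neg
  refine Eq.subst (motive := fun f => LogBdd f h) ?_ this
  funext p q
  ring

lemma logBdd_polar_step (c : ℕ) {v : List ℕ} {k : ℕ} (hv : ∀ k ∈ v, 0 < k) (hk : 0 < k) :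
    LogBdd (fun p q => polar c (v ++ [k]) (p + 1) q - polar c (v ++ [k]) p (q + 1))
      fun p q => ((p : ℝ) + 1)⁻¹ + ((q : ℝ) + 1)⁻¹ := by
  refine LogBdd.sub_antidiagonal (fun p q => by positivity)
    ((logBdd_polar_succ_left c ?_ (by simp)).mono fun p q => ?_)
    ((logBdd_polar_succ_right c hv hk (m := 1) hk).mono fun p q => ?_)
  · intro z hz
    rcases List.mem_append.1 hz with h | h
    · exact hv z h
    · rw [List.mem_singleton.1 h]
      exact hk
  · exact le_add_of_nonneg_right (by positivity)
  · rw [pow_one]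
    exact le_add_of_nonneg_left (by positivity)

lemma logBdd_polar_one {v : List ℕ} {k : ℕ} (hv : ∀ k ∈ v, 0 < k) (hk : 2 ≤ k) :
    LogBdd (polar 1 (v ++ [k])) fun p q => ((p : ℝ) + 1)⁻¹ + ((q : ℝ) + 1)⁻¹ := by
  induction v with
  | nil =>
    rw [show polar 1 ([] ++ [k]) = fun _ _ => 0 from
      funext fun p => funext fun q => polar_one_singleton hk p q]
    exact LogBdd.zero
  | cons k' v ih =>
    have hv' : ∀ k ∈ v, 0 < k := fun z hz => hv z (by simp [hz])
    have hk' : 0 < k' := hv k' (by simp)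
    have hvk : ∀ z ∈ v ++ [k], 0 < z := by
      intro z hz
      rcases List.mem_append.1 hz with h | h
      · exact hv' z h
      · rw [List.mem_singleton.1 h]
        omega
    set H : ℕ → ℕ → ℝ := fun p q => 2 * (((p : ℝ) + 1)⁻¹ ^ 2 + ((q : ℝ) + 1)⁻¹ ^ 2) with hH
    have hHnn : ∀ p q, 0 ≤ H p q := fun p q => by simp only [hH]; positivity
    have hleft : LogBdd (fun p q => polar 1 (k' :: v ++ [k]) (p + 1) q -
        polar 1 (k' :: v ++ [k]) p q) H := by
      simp only [List.cons_append, polar_succ_left hk', add_sub_cancel_left]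
      refine LogBdd.sum hHnn _ fun a _ => ?_
      have hcoef : ∀ m ≤ k' + a, LogBdd (fun p _ => (-1) ^ a * (Nat.choose (k' - 1 + a) a : ℝ) *
          (-((p : ℝ) + 1))⁻¹ ^ (k' + a)) fun p _ => ((p : ℝ) + 1)⁻¹ ^ m := by
        intro m hm
        refine LogBdd.of_le (Nat.choose (k' - 1 + a) a : ℝ) (by positivity) fun p q => ?_
        rw [abs_coeff_le (abs_neg_succ_inv p)]
        have := succ_inv_pow_le p hm
        gcongr
      rcases Nat.eq_zero_or_pos a with rfl | ha
      · refine ((hcoef 1 (by omega)).mul (ih hv')).mono fun p q => ?_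
        simp only [hH]
        nlinarith [sq_nonneg (((p : ℝ) + 1)⁻¹ - ((q : ℝ) + 1)⁻¹), sq_nonneg ((p : ℝ) + 1)⁻¹,
          sq_nonneg ((q : ℝ) + 1)⁻¹]
      · refine ((hcoef 2 (by omega)).mul (logBdd_polar (1 + a) hvk)).mono fun p q => ?_
        simp only [hH]
        nlinarith [sq_nonneg ((p : ℝ) + 1)⁻¹, sq_nonneg ((q : ℝ) + 1)⁻¹]
    have hright : LogBdd (fun p q => polar 1 (k' :: v ++ [k]) p (q + 1) -
        polar 1 (k' :: v ++ [k]) p q) H := by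
      refine (logBdd_polar_succ_right 1 hv (by omega) hk).mono fun p q => ?_
      simp only [hH]
      nlinarith [sq_nonneg ((p : ℝ) + 1)⁻¹, sq_nonneg ((q : ℝ) + 1)⁻¹]
    obtain ⟨C, hC, r, hstep⟩ := LogBdd.sub_antidiagonal hHnn hleft hright
    refine ⟨8 * C, by positivity, r + 1, fun p q => ?_⟩
    set S := p + q with hS
    have hharm := harm_nonneg S
    have h1 := abs_le_of_step_of_sum_eq_zero
      (d := fun i => polar 1 (k' :: v ++ [k]) i (S - i)) (B := 2 * (C * (1 + harm S) ^ r))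
      (by positivity) (S := S) (fun p' q' h => ?_)
      (sum_polar_one_eq_zero ?_ (by simp) ?_ S) (p := p) (q := q) rfl
    · simp only [show S - p = q by omega] at h1
      refine h1.trans ?_
      have h2 : harm (S + 1) ≤ harm S + 1 := by
        rw [harm_succ]
        have : ((S : ℝ) + 1)⁻¹ ≤ 1 := inv_le_one_of_one_le₀ (by simp)
        linarith
      calc _ ≤ 2 * (2 * (C * (1 + harm S) ^ r)) * (2 * (1 + harm S)) *
            (((p : ℝ) + 1)⁻¹ + ((q : ℝ) + 1)⁻¹) := by gcongr; linarith
        _ = _ := by ring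
    · simp only [show S - (p' + 1) = q' by omega, show S - p' = q' + 1 by omega]
      refine (hstep p' q').trans ?_
      have h2 : harm (p' + q') ≤ harm S := harm_mono (by omega)
      have h3 := harm_nonneg (p' + q')
      simp only [hH]
      calc _ ≤ C * (1 + harm S) ^ r * (2 * (((p' : ℝ) + 1)⁻¹ ^ 2 + ((q' : ℝ) + 1)⁻¹ ^ 2)) := by
            gcongr
        _ = _ := by ring
    · intro z hz
      rcases List.mem_append.1 hz with h | h
      · exact hv z h
      · rw [List.mem_singleton.1 h]
        omega
    · simp only [List.sum_append, List.sum_singleton]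
      omega

lemma abs_sub_mid_le {d : ℕ → ℝ} {B : ℝ} (hB : 0 ≤ B) {N : ℕ}
    (h : ∀ i < N, |d (i + 1) - d i| ≤ B * (((N - 1 - i : ℕ) : ℝ) + 1)⁻¹) {j : ℕ} (hj : j ≤ N) :
    (N : ℝ) * |d j - d 0| ≤ B * (1 + harm N) * j := by
  have h1 : |d j - d 0| ≤ B * ∑ i ∈ Finset.range j, (((N - 1 - i : ℕ) : ℝ) + 1)⁻¹ := by
    rw [← Finset.sum_range_sub, Finset.mul_sum]
    refine (Finset.abs_sum_le_sum_abs _ _).trans (Finset.sum_le_sum fun i hi => h i ?_)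
    have := Finset.mem_range.1 hi
    omega
  have h2 : ∑ i ∈ Finset.range j, (((N - 1 - i : ℕ) : ℝ) + 1)⁻¹ ≤ harm N := by
    rw [← sum_range_reflect_inv N]
    exact Finset.sum_le_sum_of_subset_of_nonneg (Finset.range_subset_range.2 hj)
      fun i _ _ => by positivity
  have h3 : (N : ℝ) * ∑ i ∈ Finset.range j, (((N - 1 - i : ℕ) : ℝ) + 1)⁻¹ ≤
      j + j * ∑ i ∈ Finset.range j, (((N - 1 - i : ℕ) : ℝ) + 1)⁻¹ := by
    have h4 : (j : ℝ) = ∑ i ∈ Finset.range j, (1 : ℝ) := by simp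
    conv_rhs => enter [1]; rw [h4]
    rw [Finset.mul_sum, Finset.mul_sum, ← Finset.sum_add_distrib]
    refine Finset.sum_le_sum fun i hi => ?_
    have hi' := Finset.mem_range.1 hi
    have hN : (N : ℝ) = ((N - 1 - i : ℕ) : ℝ) + 1 + i := by
      exact_mod_cast (show N = (N - 1 - i) + 1 + i by omega)
    have hpos : (((N - 1 - i : ℕ) : ℝ) + 1) ≠ 0 := by positivity
    have hij : (i : ℝ) ≤ j := by exact_mod_cast hi'.le
    have h5 : (N : ℝ) * (((N - 1 - i : ℕ) : ℝ) + 1)⁻¹ =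
        1 + i * (((N - 1 - i : ℕ) : ℝ) + 1)⁻¹ := by
      nth_rewrite 1 [hN]
      field_simp
    rw [h5]
    gcongr
  calc _ ≤ (N : ℝ) * (B * ∑ i ∈ Finset.range j, (((N - 1 - i : ℕ) : ℝ) + 1)⁻¹) := by gcongr
    _ = B * ((N : ℝ) * ∑ i ∈ Finset.range j, (((N - 1 - i : ℕ) : ℝ) + 1)⁻¹) := by ring
    _ ≤ B * (j + j * ∑ i ∈ Finset.range j, (((N - 1 - i : ℕ) : ℝ) + 1)⁻¹) := by gcongr
    _ ≤ B * (j + j * harm N) := by gcongr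
    _ = _ := by ring

end Steps

section Limit

open Filter Topology

lemma tendsto_zero_of_nat_mul_le {f : ℕ → ℝ} {C : ℝ} {r : ℕ}
    (h : ∀ N : ℕ, (N : ℝ) * |f N| ≤ C * (1 + harm N) ^ r) : Tendsto f atTop (𝓝 0) := by
  have h1 := (tendsto_one_add_harm_pow_div r).const_mul (2 * C)
  rw [mul_zero] at h1
  refine squeeze_zero_norm' ?_ h1
  filter_upwards [eventually_ge_atTop 1] with N hN
  have hN' : (1 : ℝ) ≤ N := by exact_mod_cast hN
  rw [Real.norm_eq_abs, ← mul_div_assoc, le_div_iff₀ (by positivity)]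
  have := h N
  nlinarith [abs_nonneg (f N)]

lemma one_add_harm_two_mul_le (N : ℕ) : 1 + harm (N + N) ≤ 2 * (1 + harm N) := by
  have h : harm (N + N) ≤ harm N + 1 := by
    rw [harm, Finset.sum_range_add]
    refine add_le_add le_rfl ?_
    calc _ ≤ ∑ i ∈ Finset.range N, ((N : ℝ) + 1)⁻¹ := by
          refine Finset.sum_le_sum fun i _ => ?_
          push_cast
          gcongr
          simp
      _ ≤ 1 := by
          rw [Finset.sum_const, Finset.card_range, nsmul_eq_mul, ← div_eq_mul_inv,
            div_le_one (by positivity)]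
          simp
  have := harm_nonneg N
  linarith

lemma LogBdd.exists_bound {g h : ℕ → ℕ → ℝ} (hh : ∀ p q, 0 ≤ h p q) (hg : LogBdd g h) :
    ∃ C : ℝ, 0 ≤ C ∧ ∃ r : ℕ, ∀ N p q, p + q ≤ N + N →
      |g p q| ≤ C * (1 + harm N) ^ r * h p q := by
  obtain ⟨C, hC, r, H⟩ := hg
  refine ⟨C * 2 ^ r, by positivity, r, fun N p q hpq => (H p q).trans ?_⟩
  refine mul_le_mul_of_nonneg_right ?_ (hh p q)
  rw [mul_assoc, ← mul_pow]
  have h1 : harm (p + q) ≤ harm (N + N) := harm_mono hpq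
  have h2 := one_add_harm_two_mul_le N
  have h3 := harm_nonneg (p + q)
  refine mul_le_mul_of_nonneg_left (pow_le_pow_left₀ (by positivity) (by linarith) _) hC

/-- The contribution of the poles of order `c` to the expansion at the midpoint. -/
noncomputable def poleSum (c : ℕ) (w : List ℕ) (N : ℕ) : ℝ :=
  ∑ j ∈ Finset.range N, ((j : ℝ) + 1)⁻¹ ^ c *
    ((-1) ^ c * polar c w (N - (j + 1)) (N + (j + 1)) + polar c w (N + (j + 1)) (N - (j + 1)))

lemma sum_erase_mid (F : ℕ → ℝ) (N : ℕ) :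
    ∑ n ∈ (Finset.range (2 * N + 1)).erase N, F n =
      ∑ j ∈ Finset.range N, (F (N - (j + 1)) + F (N + (j + 1))) := by
  have h1 : ∑ n ∈ Finset.range (2 * N + 1), F n =
      ∑ n ∈ Finset.range N, F n + (∑ j ∈ Finset.range N, F (N + (j + 1)) + F N) := by
    rw [show 2 * N + 1 = N + (N + 1) by ring, Finset.sum_range_add, Finset.sum_range_succ']
    rfl
  have h2 := Finset.sum_erase_add (Finset.range (2 * N + 1)) F
    (Finset.mem_range.2 (show N < 2 * N + 1 by omega))
  have h3 := Finset.sum_range_reflect F N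
  have h4 : ∀ j, N - (j + 1) = N - 1 - j := fun j => by omega
  have h5 : ∑ j ∈ Finset.range N, F (N - (j + 1)) = ∑ j ∈ Finset.range N, F (N - 1 - j) :=
    Finset.sum_congr rfl fun j _ => by rw [h4]
  rw [Finset.sum_add_distrib, h5]
  linarith

lemma polar_zero_eq_sum_poleSum {w : List ℕ} (hw : ∀ k ∈ w, 0 < k) (hne : w ≠ []) (N : ℕ) :
    polar 0 w N N = ∑ c ∈ Finset.Icc 1 w.sum, poleSum c w N := by
  rw [polar_zero_expand hw hne, Finset.sum_comm]
  refine Finset.sum_congr rfl fun c _ => ?_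
  rw [sum_erase_mid, poleSum]
  refine Finset.sum_congr rfl fun j hj => ?_
  have hj' := Finset.mem_range.1 hj
  have h1 : ((N - (j + 1) : ℕ) : ℝ) - N = -((j : ℝ) + 1) := by
    rw [Nat.cast_sub (by omega)]
    push_cast
    ring
  have h2 : ((N + (j + 1) : ℕ) : ℝ) - N = (j : ℝ) + 1 := by
    push_cast
    ring
  rw [h1, h2, show 2 * N - (N - (j + 1)) = N + (j + 1) by omega,
    show 2 * N - (N + (j + 1)) = N - (j + 1) by omega, inv_neg, neg_pow]
  ring

lemma tendsto_poleSum_one {v : List ℕ} {k : ℕ} (hv : ∀ k ∈ v, 0 < k) (hk : 2 ≤ k) :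
    Tendsto (poleSum 1 (v ++ [k])) atTop (𝓝 0) := by
  obtain ⟨C, hC, r, H⟩ := (logBdd_polar_one hv hk).exists_bound fun p q => by positivity
  refine tendsto_zero_of_nat_mul_le (C := 8 * C) (r := r + 1) fun N => ?_
  have hharm := harm_nonneg N
  have hterm : ∀ j ∈ Finset.range N, |((j : ℝ) + 1)⁻¹ ^ 1 *
      ((-1) ^ 1 * polar 1 (v ++ [k]) (N - (j + 1)) (N + (j + 1)) +
        polar 1 (v ++ [k]) (N + (j + 1)) (N - (j + 1)))| ≤
      4 * C * (1 + harm N) ^ r * (((j : ℝ) + 1)⁻¹ * (((N - 1 - j : ℕ) : ℝ) + 1)⁻¹) := by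
    intro j hj
    have hj' := Finset.mem_range.1 hj
    have e : N - (j + 1) = N - 1 - j := by omega
    rw [e]
    have h1 := H N (N - 1 - j) (N + (j + 1)) (by omega)
    have h2 := H N (N + (j + 1)) (N - 1 - j) (by omega)
    have h3 : (((N + (j + 1) : ℕ) : ℝ) + 1)⁻¹ ≤ (((N - 1 - j : ℕ) : ℝ) + 1)⁻¹ := by
      gcongr
      omega
    have hx : (0 : ℝ) ≤ C * (1 + harm N) ^ r := by positivity
    have hy : (0 : ℝ) ≤ ((j : ℝ) + 1)⁻¹ := by positivity
    rw [abs_mul, pow_one, pow_one, abs_of_nonneg hy, neg_one_mul]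
    have h4 : |-polar 1 (v ++ [k]) (N - 1 - j) (N + (j + 1)) +
        polar 1 (v ++ [k]) (N + (j + 1)) (N - 1 - j)| ≤
        C * (1 + harm N) ^ r * (4 * (((N - 1 - j : ℕ) : ℝ) + 1)⁻¹) := by
      refine (abs_add_le _ _).trans ?_
      rw [abs_neg]
      refine (add_le_add h1 h2).trans ?_
      rw [← mul_add]
      refine mul_le_mul_of_nonneg_left ?_ hx
      linarith
    refine (mul_le_mul_of_nonneg_left h4 hy).trans_eq ?_
    ring
  have hsum : (N : ℝ) * ∑ j ∈ Finset.range N, (((j : ℝ) + 1)⁻¹ * (((N - 1 - j : ℕ) : ℝ) + 1)⁻¹) ≤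
      2 * harm N := by
    have h1 : harm N + harm N = ∑ j ∈ Finset.range N,
        (((j : ℝ) + 1)⁻¹ + (((N - 1 - j : ℕ) : ℝ) + 1)⁻¹) := by
      rw [Finset.sum_add_distrib, sum_range_reflect_inv]
      rfl
    rw [two_mul, h1, Finset.mul_sum]
    refine Finset.sum_le_sum fun j hj => ?_
    have hj' := Finset.mem_range.1 hj
    have hN : (N : ℝ) = ((N - 1 - j : ℕ) : ℝ) + 1 + j := by
      exact_mod_cast (show N = (N - 1 - j) + 1 + j by omega)
    have hj0 : (0 : ℝ) ≤ j := by positivity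
    have hj1 : (0 : ℝ) ≤ ((N - 1 - j : ℕ) : ℝ) := by positivity
    rw [inv_add_inv (by positivity) (by positivity), ← mul_inv, ← div_eq_mul_inv]
    gcongr
    linarith
  calc _ ≤ (N : ℝ) * ∑ j ∈ Finset.range N, 4 * C * (1 + harm N) ^ r *
        (((j : ℝ) + 1)⁻¹ * (((N - 1 - j : ℕ) : ℝ) + 1)⁻¹) := by
        refine mul_le_mul_of_nonneg_left ?_ (by positivity)
        exact (Finset.abs_sum_le_sum_abs _ _).trans (Finset.sum_le_sum hterm)
    _ = 4 * C * (1 + harm N) ^ r * ((N : ℝ) * ∑ j ∈ Finset.range N,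
        (((j : ℝ) + 1)⁻¹ * (((N - 1 - j : ℕ) : ℝ) + 1)⁻¹)) := by
        rw [← Finset.mul_sum]
        ring
    _ ≤ 4 * C * (1 + harm N) ^ r * (2 * harm N) := by gcongr
    _ ≤ 4 * C * (1 + harm N) ^ r * (2 * (1 + harm N)) := by gcongr; linarith
    _ = _ := by ring

lemma tendsto_poleSum_sub {v : List ℕ} {k : ℕ} (hv : ∀ k ∈ v, 0 < k) (hk : 0 < k) {c : ℕ}
    (hc : 2 ≤ c) :
    Tendsto (fun N => poleSum c (v ++ [k]) N -
      ((-1) ^ c + 1) * (∑ j ∈ Finset.range N, ((j : ℝ) + 1)⁻¹ ^ c) * polar c (v ++ [k]) N N)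
      atTop (𝓝 0) := by
  obtain ⟨C, hC, r, H⟩ := (logBdd_polar_step c hv hk).exists_bound fun p q => by positivity
  refine tendsto_zero_of_nat_mul_le (C := 4 * C) (r := r + 2) fun N => ?_
  have hharm := harm_nonneg N
  set B := 2 * (C * (1 + harm N) ^ r) with hB
  have hB0 : 0 ≤ B := by positivity
  have h1 : ∀ j ≤ N, (N : ℝ) * |polar c (v ++ [k]) (N + j) (N - j) - polar c (v ++ [k]) N N| ≤
      B * (1 + harm N) * j := by
    intro j hj
    refine abs_sub_mid_le (d := fun j => polar c (v ++ [k]) (N + j) (N - j)) hB0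
      (fun i hi => ?_) hj
    have h := H N (N + i) (N - 1 - i) (by omega)
    rw [show N - 1 - i + 1 = N - i by omega] at h
    simp only [← add_assoc, show N - (i + 1) = N - 1 - i by omega]
    refine h.trans ?_
    rw [hB, mul_comm 2, mul_assoc _ 2]
    refine mul_le_mul_of_nonneg_left ?_ (by positivity)
    rw [two_mul]
    gcongr
    omega
  have h2 : ∀ j ≤ N, (N : ℝ) * |polar c (v ++ [k]) (N - j) (N + j) - polar c (v ++ [k]) N N| ≤
      B * (1 + harm N) * j := by
    intro j hj
    refine abs_sub_mid_le (d := fun j => polar c (v ++ [k]) (N - j) (N + j)) hB0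
      (fun i hi => ?_) hj
    have h := H N (N - 1 - i) (N + i) (by omega)
    rw [show N - 1 - i + 1 = N - i by omega, abs_sub_comm] at h
    simp only [← add_assoc, show N - (i + 1) = N - 1 - i by omega]
    refine h.trans ?_
    rw [hB, mul_comm 2, mul_assoc _ 2]
    refine mul_le_mul_of_nonneg_left ?_ (by positivity)
    rw [two_mul]
    gcongr
    omega
  have h3 : poleSum c (v ++ [k]) N -
      ((-1) ^ c + 1) * (∑ j ∈ Finset.range N, ((j : ℝ) + 1)⁻¹ ^ c) * polar c (v ++ [k]) N N =
      ∑ j ∈ Finset.range N, ((j : ℝ) + 1)⁻¹ ^ c *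
        ((-1) ^ c * (polar c (v ++ [k]) (N - (j + 1)) (N + (j + 1)) - polar c (v ++ [k]) N N) +
        (polar c (v ++ [k]) (N + (j + 1)) (N - (j + 1)) - polar c (v ++ [k]) N N)) := by
    rw [poleSum, Finset.mul_sum, Finset.sum_mul, ← Finset.sum_sub_distrib]
    exact Finset.sum_congr rfl fun j _ => by ring
  rw [h3]
  calc _ ≤ (N : ℝ) * ∑ j ∈ Finset.range N, ((j : ℝ) + 1)⁻¹ ^ c *
        (|polar c (v ++ [k]) (N - (j + 1)) (N + (j + 1)) - polar c (v ++ [k]) N N| +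
        |polar c (v ++ [k]) (N + (j + 1)) (N - (j + 1)) - polar c (v ++ [k]) N N|) := by
        refine mul_le_mul_of_nonneg_left ?_ (by positivity)
        refine (Finset.abs_sum_le_sum_abs _ _).trans (Finset.sum_le_sum fun j _ => ?_)
        rw [abs_mul, abs_of_nonneg (by positivity : (0 : ℝ) ≤ ((j : ℝ) + 1)⁻¹ ^ c)]
        refine mul_le_mul_of_nonneg_left ((abs_add_le _ _).trans_eq ?_) (by positivity)
        rw [abs_mul, abs_pow, abs_neg, abs_one, one_pow, one_mul]
    _ ≤ ∑ j ∈ Finset.range N, (2 * (B * (1 + harm N))) * ((j : ℝ) + 1)⁻¹ := by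
        rw [Finset.mul_sum]
        refine Finset.sum_le_sum fun j hj => ?_
        have hj' := Finset.mem_range.1 hj
        have h4 := h1 (j + 1) (by omega)
        have h5 := h2 (j + 1) (by omega)
        push_cast at h4 h5
        have h6 : ((j : ℝ) + 1)⁻¹ ^ c * ((j : ℝ) + 1) ≤ ((j : ℝ) + 1)⁻¹ := by
          refine (mul_le_mul_of_nonneg_right (succ_inv_pow_le j hc) (by positivity)).trans_eq ?_
          field_simp
        calc _ = ((j : ℝ) + 1)⁻¹ ^ c *
              ((N : ℝ) * |polar c (v ++ [k]) (N - (j + 1)) (N + (j + 1)) -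
                polar c (v ++ [k]) N N| +
              (N : ℝ) * |polar c (v ++ [k]) (N + (j + 1)) (N - (j + 1)) -
                polar c (v ++ [k]) N N|) := by ring
          _ ≤ ((j : ℝ) + 1)⁻¹ ^ c * (B * (1 + harm N) * ((j : ℝ) + 1) +
              B * (1 + harm N) * ((j : ℝ) + 1)) := by gcongr
          _ = (2 * (B * (1 + harm N))) * (((j : ℝ) + 1)⁻¹ ^ c * ((j : ℝ) + 1)) := by ring
          _ ≤ _ := by gcongr
    _ = (2 * (B * (1 + harm N))) * harm N := by
        rw [← Finset.mul_sum]
        rfl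
    _ ≤ (2 * (B * (1 + harm N))) * (1 + harm N) := by gcongr; linarith
    _ = _ := by rw [hB]; ring

lemma nat_mul_abs_sum_sub_le {c : ℕ} (hc : 2 ≤ c) {z : ℝ}
    (hz : Tendsto (fun N => ∑ j ∈ Finset.range N, ((j : ℝ) + 1)⁻¹ ^ c) atTop (𝓝 z)) (N : ℕ) :
    (N : ℝ) * |∑ j ∈ Finset.range N, ((j : ℝ) + 1)⁻¹ ^ c - z| ≤ 1 := by
  set s : ℕ → ℝ := fun N => ∑ j ∈ Finset.range N, ((j : ℝ) + 1)⁻¹ ^ c with hs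
  have hmono : Monotone s := monotone_nat_of_le_succ fun M => by
    simp only [hs, Finset.sum_range_succ]
    exact le_add_of_nonneg_right (by positivity)
  rcases Nat.eq_zero_or_pos N with rfl | hN
  · simp
  have hle : s N ≤ z := hmono.ge_of_tendsto hz N
  have hanti : Antitone fun M : ℕ => s (M + 1) + ((M : ℝ) + 1)⁻¹ :=
    antitone_nat_of_succ_le fun M => by
      have h1 : s (M + 1 + 1) = s (M + 1) + (((M + 1 : ℕ) : ℝ) + 1)⁻¹ ^ c :=
        Finset.sum_range_succ _ _
      have h2 := succ_inv_pow_le (M + 1) hc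
      have h3 : (((M + 1 : ℕ) : ℝ) + 1)⁻¹ ^ 2 + (((M + 1 : ℕ) : ℝ) + 1)⁻¹ ≤ ((M : ℝ) + 1)⁻¹ := by
        push_cast
        rw [← sub_nonneg]
        have : ((M : ℝ) + 1)⁻¹ - (((M : ℝ) + 1 + 1)⁻¹ ^ 2 + ((M : ℝ) + 1 + 1)⁻¹) =
            ((M : ℝ) + 1)⁻¹ * ((M : ℝ) + 1 + 1)⁻¹ ^ 2 := by
          field_simp
          ring
        rw [this]
        positivity
      rw [h1]
      linarith
  have hlim : Tendsto (fun M : ℕ => s (M + 1) + ((M : ℝ) + 1)⁻¹) atTop (𝓝 z) := by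
    have := ((tendsto_add_atTop_iff_nat 1).2 hz).add tendsto_one_div_add_atTop_nhds_zero_nat
    simpa only [add_zero, one_div] using this
  obtain ⟨M, rfl⟩ : ∃ M, N = M + 1 := ⟨N - 1, by omega⟩
  have h1 := hanti.le_of_tendsto hlim M
  rw [abs_sub_comm, abs_of_nonneg (by linarith)]
  have h2 : z - s (M + 1) ≤ ((M : ℝ) + 1)⁻¹ := by
    have h3 : z ≤ s (M + 1) + ((M : ℝ) + 1)⁻¹ := h1
    linarith
  push_cast
  calc _ ≤ ((M : ℝ) + 1) * ((M : ℝ) + 1)⁻¹ := by gcongr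
    _ = 1 := mul_inv_cancel₀ (by positivity)

/-- The coefficient `(-1)^m (2π)^{2m} B_{2m} / (2m)!`. -/
noncomputable def bernCoeff (m : ℕ) : ℝ :=
  (-1) ^ m * ((2 * π) ^ (2 * m) * ((bernoulli (2 * m) : ℚ) : ℝ) / Nat.factorial (2 * m))

lemma bernCoeff_zero : bernCoeff 0 = 1 := by simp [bernCoeff]

lemma tendsto_sum_even {m : ℕ} (hm : 0 < m) :
    Tendsto (fun N => ∑ j ∈ Finset.range N, ((j : ℝ) + 1)⁻¹ ^ (2 * m)) atTop
      (𝓝 (-bernCoeff m / 2)) := by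
  have h := (hasSum_zeta_nat hm.ne').tendsto_sum_nat
  rw [← tendsto_add_atTop_iff_nat 1] at h
  convert h using 1
  · funext N
    rw [Finset.sum_range_succ']
    simp [hm.ne']
  · congr 1
    obtain ⟨m, rfl⟩ : ∃ m', m = m' + 1 := ⟨m - 1, by omega⟩
    rw [bernCoeff, show 2 * (m + 1) - 1 = 2 * m + 1 by omega, mul_pow]
    ring

/-- The coefficient of `T^c` in the Taylor expansion of `π T cot (π T)`. -/
noncomputable def poleCoeff (c : ℕ) : ℝ := if Even c then bernCoeff (c / 2) else 0

lemma tendsto_poleSum_add {v : List ℕ} {k : ℕ} (hv : ∀ k ∈ v, 0 < k) (hk : 2 ≤ k) {c : ℕ}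
    (hc : 0 < c) :
    Tendsto (fun N => poleSum c (v ++ [k]) N + poleCoeff c * polar c (v ++ [k]) N N)
      atTop (𝓝 0) := by
  have hvk : ∀ z ∈ v ++ [k], 0 < z := by
    intro z hz
    rcases List.mem_append.1 hz with h | h
    · exact hv z h
    · rw [List.mem_singleton.1 h]
      omega
  rcases Nat.even_or_odd c with hev | hodd
  · obtain ⟨m, rfl⟩ := hev.two_dvd
    have hm : 0 < m := by omega
    have h1 := tendsto_poleSum_sub hv (show 0 < k by omega) (show 2 ≤ 2 * m by omega)
    obtain ⟨C, hC, r, H⟩ := (logBdd_polar (2 * m) hvk).exists_bound fun p q => zero_le_one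
    have h2 : Tendsto (fun N => 2 * (∑ j ∈ Finset.range N, ((j : ℝ) + 1)⁻¹ ^ (2 * m) -
        (-bernCoeff m / 2)) * polar (2 * m) (v ++ [k]) N N) atTop (𝓝 0) := by
      refine tendsto_zero_of_nat_mul_le (C := 2 * C) (r := r) fun N => ?_
      have h3 := nat_mul_abs_sum_sub_le (show 2 ≤ 2 * m by omega) (tendsto_sum_even hm) N
      have h4 := H N N N le_rfl
      rw [mul_one] at h4
      rw [abs_mul, abs_mul, abs_two]
      calc _ = 2 * ((N : ℝ) * |∑ j ∈ Finset.range N, ((j : ℝ) + 1)⁻¹ ^ (2 * m) -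
            (-bernCoeff m / 2)|) * |polar (2 * m) (v ++ [k]) N N| := by ring
        _ ≤ 2 * 1 * (C * (1 + harm N) ^ r) := by gcongr
        _ = _ := by ring
    have h5 := h1.add h2
    rw [add_zero] at h5
    refine h5.congr fun N => ?_
    rw [poleCoeff, if_pos hev, Nat.mul_div_cancel_left m two_pos, pow_mul, neg_one_sq, one_pow]
    ring
  · have hcoef : poleCoeff c = 0 := if_neg (Nat.not_even_iff_odd.2 hodd)
    simp only [hcoef, zero_mul, add_zero]
    rcases Nat.lt_or_ge c 2 with h | h
    · obtain rfl : c = 1 := by omega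
      exact tendsto_poleSum_one hv hk
    · have h1 := tendsto_poleSum_sub hv (show 0 < k by omega) h
      simpa [hodd.neg_one_pow] using h1

/-- The finite form of the key relation holds up to an error tending to `0`. -/
lemma tendsto_sum_poleCoeff_mul_polar {v : List ℕ} {k : ℕ} (hv : ∀ k ∈ v, 0 < k) (hk : 2 ≤ k) :
    Tendsto (fun N => ∑ c ∈ Finset.range ((v ++ [k]).sum + 1),
      poleCoeff c * polar c (v ++ [k]) N N) atTop (𝓝 0) := by
  have hvk : ∀ z ∈ v ++ [k], 0 < z := by
    intro z hz
    rcases List.mem_append.1 hz with h | h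
    · exact hv z h
    · rw [List.mem_singleton.1 h]
      omega
  have h1 := tendsto_finsetSum (Finset.Icc 1 (v ++ [k]).sum) fun c hc =>
    tendsto_poleSum_add hv hk (show 0 < c from (Finset.mem_Icc.1 hc).1)
  rw [Finset.sum_const_zero] at h1
  refine h1.congr fun N => ?_
  rw [Finset.sum_add_distrib, ← polar_zero_eq_sum_poleSum hvk (by simp),
    Finset.range_eq_Ico, Finset.sum_eq_sum_Ico_succ_bot (by omega)]
  have h0 : poleCoeff 0 = 1 := by simp [poleCoeff, bernCoeff_zero]
  rw [h0, one_mul]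
  rfl

end Limit

section Relation

/-- The contribution of the `j`-th entry of `w` to `relSum`. -/
noncomputable def relTerm (Z : List ℕ → ℝ) (w : List ℕ) (j : ℕ) : ℝ :=
  ∑ m ∈ Finset.range (w.getD j 0 / 2 + 1), bernCoeff m *
    ∑ a ∈ Finset.range (w.getD j 0 - 2 * m + 1),
      (-1) ^ ((w.take j).sum + a) * zetaA Z a (w.take j).reverse *
        zetaA Z (w.getD j 0 - 2 * m - a) (w.drop (j + 1))

/-- The sum over all splittings of `w` of the signed products of `Z` on the reversed left part
and on the right part. -/
noncomputable def splitSum (Z : List ℕ → ℝ) (w : List ℕ) : ℝ :=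
  ∑ i ∈ Finset.range (w.length + 1), (-1) ^ (w.take i).sum * (Z (w.take i).reverse * Z (w.drop i))

/-- The expression whose vanishing is the key relation. -/
noncomputable def relSum (Z : List ℕ → ℝ) (w : List ℕ) : ℝ :=
  splitSum Z w + ∑ j ∈ Finset.range w.length, relTerm Z w j

lemma sum_even_eq (f : ℕ → ℝ) (n : ℕ) :
    ∑ c ∈ Finset.range (n + 1), (if Even c then f c else 0) =
      ∑ m ∈ Finset.range (n / 2 + 1), f (2 * m) := by
  rw [← Finset.sum_filter]
  refine (Finset.sum_nbij' (fun m => 2 * m) (fun c => c / 2) ?_ ?_ ?_ ?_ ?_).symm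
  · intro m hm
    simp only [Finset.mem_filter, Finset.mem_range] at hm ⊢
    exact ⟨by omega, even_two_mul m⟩
  · intro c hc
    simp only [Finset.mem_filter, Finset.mem_range] at hc ⊢
    omega
  · intro m _
    simp
  · intro c hc
    exact Nat.two_mul_div_two_of_even (Finset.mem_filter.1 hc).2
  · intro m _
    rfl

lemma sum_poleCoeff_mul_polar_eq {w : List ℕ} (hw : ∀ k ∈ w, 0 < k) (N : ℕ) :
    ∑ c ∈ Finset.range (w.sum + 1), poleCoeff c * polar c w N N =
      relSum (qsym (recips N)) w := by
  simp only [polar_eq, mul_add, Finset.sum_add_distrib, relSum, splitSum, relTerm]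
  have htake : ∀ i, ∀ k ∈ w.take i, 0 < k := fun i k h => hw k (List.mem_of_mem_take h)
  have hdrop : ∀ i, ∀ k ∈ w.drop i, 0 < k := fun i k h => hw k (List.mem_of_mem_drop h)
  congr 1
  · rw [Finset.sum_eq_single_of_mem 0 (by simp) fun c _ hc => by rw [if_neg hc, mul_zero]]
    rw [if_pos rfl, show poleCoeff 0 = 1 by simp [poleCoeff, bernCoeff_zero], one_mul]
    refine Finset.sum_congr rfl fun i _ => ?_
    rw [coeff_hurwNeg N (htake i), coeff_hurw N (hdrop i), zetaA_zero, zetaA_zero, add_zero,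
      mul_assoc]
  · simp only [Finset.mul_sum]
    rw [Finset.sum_comm]
    refine Finset.sum_congr rfl fun j _ => ?_
    have h1 : ∑ c ∈ Finset.range (w.sum + 1), poleCoeff c *
        (if c ≤ w.getD j 0 then PowerSeries.coeff (w.getD j 0 - c)
          (hurwNeg N (w.take j) * hurw N (w.drop (j + 1))) else 0) =
        ∑ c ∈ Finset.range (w.getD j 0 + 1), (if Even c then bernCoeff (c / 2) *
          PowerSeries.coeff (w.getD j 0 - c)
          (hurwNeg N (w.take j) * hurw N (w.drop (j + 1))) else 0) := by
      symm
      refine Finset.sum_subset_zero_on_sdiff ?_ ?_ ?_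
      · exact Finset.range_mono (Nat.succ_le_succ (getD_le_sum w j))
      · intro c hc
        simp only [Finset.mem_sdiff, Finset.mem_range] at hc
        rw [if_neg (by omega), mul_zero]
      · intro c hc
        rw [poleCoeff, ite_mul, zero_mul, if_pos (Nat.lt_succ_iff.1 (Finset.mem_range.1 hc))]
    rw [h1, sum_even_eq]
    refine Finset.sum_congr rfl fun m _ => ?_
    rw [Nat.mul_div_cancel_left m two_pos, PowerSeries.coeff_mul,
      Finset.Nat.sum_antidiagonal_eq_sum_range_succ_mk, Finset.mul_sum]
    refine Finset.sum_congr rfl fun a _ => ?_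
    rw [coeff_hurwNeg N (htake j), coeff_hurw N (hdrop (j + 1))]

lemma relSum_pair_mem {Z : List ℕ → ℝ} (hZ : IsStuffleReg Z) {w : List ℕ} (hw : ∀ k ∈ w, 0 < k) :
    (relSum Z w, fun M => relSum (qsym (recips M)) w) ∈ regPairs (Z [1]) := by
  have htake : ∀ i, ∀ k ∈ (w.take i).reverse, 0 < k := fun i k h =>
    hw k (List.mem_of_mem_take (List.mem_reverse.1 h))
  have hdrop : ∀ i, ∀ k ∈ w.drop i, 0 < k := fun i k h => hw k (List.mem_of_mem_drop h)
  have key : (∑ i ∈ Finset.range (w.length + 1), ((-1 : ℝ) ^ (w.take i).sum) •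
        (zpair Z (w.take i).reverse * zpair Z (w.drop i)) +
      ∑ j ∈ Finset.range w.length, ∑ m ∈ Finset.range (w.getD j 0 / 2 + 1), bernCoeff m •
        ∑ a ∈ Finset.range (w.getD j 0 - 2 * m + 1), ((-1 : ℝ) ^ ((w.take j).sum + a)) •
          (((zetaA Z a (w.take j).reverse,
              fun M => zetaA (qsym (recips M)) a (w.take j).reverse) : ℝ × (ℕ → ℝ)) *
            (zetaA Z (w.getD j 0 - 2 * m - a) (w.drop (j + 1)),
              fun M => zetaA (qsym (recips M)) (w.getD j 0 - 2 * m - a) (w.drop (j + 1))))) ∈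
      regPairs (Z [1]) := by
    refine add_mem (sum_mem fun i _ => ?_) (sum_mem fun j _ => sum_mem fun m _ => ?_)
    · exact Subalgebra.smul_mem _ (mul_mem (zpair_mem hZ (htake i)) (zpair_mem hZ (hdrop i))) _
    · refine Subalgebra.smul_mem _ (sum_mem fun a _ => Subalgebra.smul_mem _ (mul_mem ?_ ?_) _) _
      · exact zetaA_pair_mem hZ a (htake j)
      · exact zetaA_pair_mem hZ _ (hdrop (j + 1))
  convert key using 1
  ext M
  · simp [relSum, splitSum, relTerm, zpair, Prod.fst_sum, mul_assoc]
  · simp [relSum, splitSum, relTerm, zpair, Prod.snd_sum, mul_assoc]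

lemma relSum_eq_zero {Z : List ℕ → ℝ} (hZ : IsStuffleReg Z) {v : List ℕ} {k : ℕ}
    (hv : ∀ k ∈ v, 0 < k) (hk : 2 ≤ k) : relSum Z (v ++ [k]) = 0 := by
  have hvk : ∀ z ∈ v ++ [k], 0 < z := by
    intro z hz
    rcases List.mem_append.1 hz with h | h
    · exact hv z h
    · rw [List.mem_singleton.1 h]
      omega
  refine eq_zero_of_mem_regPairs (relSum_pair_mem hZ hvk) ?_
  simpa only [sum_poleCoeff_mul_polar_eq hvk] using tendsto_sum_poleCoeff_mul_polar hv hk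

end Relation

section Assembly

lemma sum_take_eq_add (k : List ℕ) (i j : ℕ) :
    (k.take (i + j)).sum = (k.take i).sum + ((k.drop i).take j).sum := by
  rw [List.take_add, List.sum_append]

lemma sum_zetaStar_mul_splitSum {Z : List ℕ → ℝ} (hZ : IsStuffleReg Z) {k : List ℕ}
    (hk : ∀ i ∈ k, 0 < i) :
    ∑ i ∈ Finset.range (k.length + 1), (-1) ^ (i + (k.take i).sum) * zetaStarOf Z (k.take i) *
      splitSum Z (k.drop i) = Z k := by
  have h1 : ∀ i ∈ Finset.range (k.length + 1),
      (-1) ^ (i + (k.take i).sum) * zetaStarOf Z (k.take i) * splitSum Z (k.drop i) =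
      ∑ j ∈ Finset.Ico i (k.length + 1), (-1) ^ (k.take j).sum * Z (k.drop j) *
        ((-1) ^ i * zetaStarOf Z (k.take i) * Z ((k.take j).drop i).reverse) := by
    intro i hi
    have hi' := Finset.mem_range.1 hi
    rw [Finset.sum_Ico_eq_sum_range, splitSum, Finset.mul_sum, List.length_drop,
      show k.length + 1 - i = k.length - i + 1 by omega]
    refine Finset.sum_congr rfl fun j _ => ?_
    rw [sum_take_eq_add, List.drop_drop, List.drop_take, Nat.add_sub_cancel_left]
    ring
  rw [Finset.sum_congr rfl h1, Finset.sum_comm' (t' := Finset.range (k.length + 1))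
    (s' := fun j => Finset.range (j + 1)) (by
      intro i j
      simp only [Finset.mem_range, Finset.mem_Ico]
      omega)]
  have h2 : ∀ j ∈ Finset.range k.length, ∑ i ∈ Finset.range (j + 1 + 1),
      (-1) ^ (k.take (j + 1)).sum * Z (k.drop (j + 1)) *
        ((-1) ^ i * zetaStarOf Z (k.take i) * Z ((k.take (j + 1)).drop i).reverse) = 0 := by
    intro j hj
    have hj' := Finset.mem_range.1 hj
    have hlen : (k.take (j + 1)).length = j + 1 := by
      rw [List.length_take]
      omega
    have h3 := sum_zetaStar_mul_reverse hZ (k.take (j + 1))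
      (fun h => by rw [h] at hlen; simp at hlen) fun i hi => hk i (List.mem_of_mem_take hi)
    rw [hlen] at h3
    rw [← Finset.mul_sum, ← mul_zero ((-1) ^ (k.take (j + 1)).sum * Z (k.drop (j + 1))), ← h3]
    congr 1
    refine Finset.sum_congr rfl fun i hi => ?_
    rw [List.take_take, min_eq_left (by have := Finset.mem_range.1 hi; omega)]
  rw [Finset.sum_range_succ', Finset.sum_eq_zero h2]
  simp [zetaStarOf, contractions, hZ.empty]

lemma sum_zetaStar_mul_relTerm (Z : List ℕ → ℝ) (k : List ℕ) :
    ∑ i ∈ Finset.range k.length, (-1) ^ (i + (k.take i).sum) * zetaStarOf Z (k.take i) *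
      ∑ j ∈ Finset.range (k.drop i).length, relTerm Z (k.drop i) j =
    2 * ∑ j ∈ Finset.Icc 1 k.length, ∑ i ∈ Finset.range j,
        ∑ m ∈ Finset.range (k.getD (j - 1) 0 / 2 + 1),
          ∑ a ∈ Finset.range (k.getD (j - 1) 0 - 2 * m + 1),
            (-1 : ℝ) ^ (m + i + (k.getD (j - 1) 0 - 2 * m - a) + (k.take j).sum) *
              ((2 * π) ^ (2 * m) * ((bernoulli (2 * m) : ℚ) : ℝ) /
                (2 * Nat.factorial (2 * m))) *
              zetaStarOf Z (k.take i) *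
              zetaA Z a (((k.take (j - 1)).drop i).reverse) *
              zetaA Z (k.getD (j - 1) 0 - 2 * m - a) (k.drop j) := by
  have h1 : ∀ i ∈ Finset.range k.length,
      (-1) ^ (i + (k.take i).sum) * zetaStarOf Z (k.take i) *
        ∑ j ∈ Finset.range (k.drop i).length, relTerm Z (k.drop i) j =
      ∑ j ∈ Finset.Ico i k.length, (-1) ^ (i + (k.take i).sum) * zetaStarOf Z (k.take i) *
        relTerm Z (k.drop i) (j - i) := by
    intro i _
    rw [Finset.sum_Ico_eq_sum_range, Finset.mul_sum, List.length_drop]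
    simp only [Nat.add_sub_cancel_left]
  rw [Finset.sum_congr rfl h1, Finset.sum_comm' (t' := Finset.range k.length)
    (s' := fun j => Finset.range (j + 1)) (by
      intro i j
      simp only [Finset.mem_range, Finset.mem_Ico]
      omega)]
  rw [← Finset.Ico_add_one_right_eq_Icc, Finset.sum_Ico_eq_sum_range, Nat.add_sub_cancel,
    Finset.mul_sum]
  refine Finset.sum_congr rfl fun j hj => ?_
  rw [add_comm 1 j, Nat.add_sub_cancel, Finset.mul_sum]
  refine Finset.sum_congr rfl fun i hi => ?_
  obtain ⟨r, rfl⟩ : ∃ r, j = i + r := ⟨j - i, by have := Finset.mem_range.1 hi; omega⟩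
  have hj' := Finset.mem_range.1 hj
  have hget : (k.drop i).getD r 0 = k.getD (i + r) 0 := by
    simp [List.getD_eq_getElem?_getD, List.getElem?_drop]
  have hsum : (k.take (i + r + 1)).sum =
      (k.take i).sum + ((k.drop i).take r).sum + k.getD (i + r) 0 := by
    rw [← sum_take_eq_add, List.sum_take_succ _ _ hj', List.getD_eq_getElem _ _ hj']
  rw [Nat.add_sub_cancel_left, relTerm, hget, Finset.mul_sum, Finset.mul_sum]
  refine Finset.sum_congr rfl fun m hm => ?_
  rw [Finset.mul_sum, Finset.mul_sum, Finset.mul_sum]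
  refine Finset.sum_congr rfl fun a ha => ?_
  have hm' := Finset.mem_range.1 hm
  have ha' := Finset.mem_range.1 ha
  rw [hsum, List.drop_drop, List.drop_take, Nat.add_sub_cancel_left, ← add_assoc]
  obtain ⟨b, hb⟩ : ∃ b, k.getD (i + r) 0 = a + 2 * m + b :=
    ⟨k.getD (i + r) 0 - 2 * m - a, by omega⟩
  rw [hb, show a + 2 * m + b - 2 * m - a = b by omega]
  have hsign : (-1 : ℝ) ^ (m + i + b + ((k.take i).sum + ((k.drop i).take r).sum +
      (a + 2 * m + b))) =
      (-1) ^ (i + (k.take i).sum) * (-1) ^ m * (-1) ^ (((k.drop i).take r).sum + a) := by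
    rw [← pow_add, ← pow_add, show m + i + b + ((k.take i).sum + ((k.drop i).take r).sum +
      (a + 2 * m + b)) = i + (k.take i).sum + m + (((k.drop i).take r).sum + a) + 2 * (m + b) by
        ring, pow_add _ _ (2 * (m + b)), pow_mul, neg_one_sq, one_pow, mul_one]
  rw [hsign, bernCoeff]
  field_simp

end Assembly

/-- Explicit parity formula (main theorem): for positive integers `k₁,…,k_d` with
`k_d ≥ 2` and `k₁+⋯+k_d ≢ d (mod 2)`,
`ζ(k₁,…,k_d) = (ζ(k₁,…,k_d) − ζ^⋆(k₁,…,k_d))/2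
  − ∑_{0≤i<j≤d} ∑_{a+2m+b=k_j} (-1)^{m+i+b+k₁+⋯+k_j} (2π)^{2m} B_{2m}/(2·(2m)!)
      ζ^{⋆,*}(k₁,…,k_i) ζ_a^*(k_{j-1},…,k_{i+1}) ζ_b(k_{j+1},…,k_d)`. -/
theorem explicit_parity (Z : List ℕ → ℝ) (hZ : IsStuffleReg Z)
    (k : List ℕ) (hk : ∀ i ∈ k, 0 < i) (hne : k ≠ []) (hlast : 2 ≤ k.getLastD 0)
    (hpar : k.sum % 2 ≠ k.length % 2) :
    MZV k = (MZV k - zetaStarOf Z k) / 2 -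
      ∑ j ∈ Finset.Icc 1 k.length, ∑ i ∈ Finset.range j,
        ∑ m ∈ Finset.range (k.getD (j - 1) 0 / 2 + 1),
          ∑ a ∈ Finset.range (k.getD (j - 1) 0 - 2 * m + 1),
            (-1 : ℝ) ^ (m + i + (k.getD (j - 1) 0 - 2 * m - a) + (k.take j).sum) *
              ((2 * π) ^ (2 * m) * ((bernoulli (2 * m) : ℚ) : ℝ) /
                (2 * Nat.factorial (2 * m))) *
              zetaStarOf Z (k.take i) *
              zetaA Z a (((k.take (j - 1)).drop i).reverse) *
              zetaA Z (k.getD (j - 1) 0 - 2 * m - a) (k.drop j) := by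
  have hZk : Z k = MZV k := hZ.conv k hk (by
    rw [List.getLastD_eq_getLast?, List.getLast?_eq_some_getLast hne] at hlast ⊢
    exact hlast)
  have hrel : ∀ i ∈ Finset.range k.length, relSum Z (k.drop i) = 0 := by
    intro i hi
    have hdrop : k.drop i ≠ [] := by
      simpa using Finset.mem_range.1 hi
    rw [← List.dropLast_append_getLast hdrop]
    refine relSum_eq_zero hZ (fun a ha => hk a ?_) ?_
    · exact List.mem_of_mem_drop (List.mem_of_mem_dropLast ha)
    · rw [List.getLastD_eq_getLast?, List.getLast?_eq_some_getLast hne] at hlast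
      rw [List.getLast_drop]
      exact hlast
  have h1 := sum_zetaStar_mul_splitSum hZ hk
  have h2 := sum_zetaStar_mul_relTerm Z k
  have hodd : Odd (k.length + k.sum) := by
    rw [Nat.odd_iff]
    omega
  have h3 : splitSum Z [] = 1 := by simp [splitSum, hZ.empty]
  rw [Finset.sum_range_succ, List.take_length, List.drop_length, hodd.neg_one_pow, h3] at h1
  have h4 : ∑ i ∈ Finset.range k.length, (-1) ^ (i + (k.take i).sum) * zetaStarOf Z (k.take i) *
      relSum Z (k.drop i) = 0 :=
    Finset.sum_eq_zero fun i hi => by rw [hrel i hi, mul_zero]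
  simp only [relSum, mul_add, Finset.sum_add_distrib] at h4
  rw [← hZk]
  linarith
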